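/- Let n ≥ 22. Then the 7th through 11th smallest elements of cd(S_n) \ {1}, in increasing order, are: d_7(S_n) = n(n−1)(n−2)(n−7)/24, d_8(S_n) = (n−1)(n−2)(n−3)(n−4)/24, d_9(S_n) = n(n−1)(n−4)(n−5)/12, d_10(S_n) = n(n−1)(n−3)(n−6)/8, and d_11(S_n) = n(n−2)(n−3)(n−5)/8. -/

import Mathlib

open CategoryTheory

/-- The set of degrees of irreducible complex representations of `G`. -/
noncomputable def cd (G : Type) [Group G] : Set ℕ :=
  {d | ∃ V : FDRep ℂ G, Simple V ∧ Module.finrank ℂ V = d}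

/-- `dDeg G i` is the `i`-th smallest nontrivial irreducible character degree of `G`,
i.e. the `i`-th smallest element of `cd G \ {1}` (indexed from `i = 1`). -/
noncomputable def dDeg (G : Type) [Group G] (i : ℕ) : ℕ :=
  Nat.nth (· ∈ cd G \ {1}) (i - 1)

namespace YoungDiagram

noncomputable instance : DecidableEq YoungDiagram := Classical.decEq _

/-- The standard fillings of `μ` by `Fin n`: maps to the cells whose order is a linear extension
of the order on cells.  They are standard Young tableaux of shape `μ` when `μ.card = n`. -/
noncomputable def syt (μ : YoungDiagram) (n : ℕ) : Finset (Fin n → ℕ × ℕ) :=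
  open Classical in
  (Fintype.piFinset fun _ => μ.cells).filter fun T => ∀ i j, T i ≤ T j → i ≤ j

/-- The number of standard Young tableaux of shape `μ`. -/
noncomputable def numSYT (μ : YoungDiagram) : ℕ := (μ.syt μ.card).card

theorem mem_syt {μ : YoungDiagram} {n : ℕ} {T : Fin n → ℕ × ℕ} :
    T ∈ μ.syt n ↔ (∀ i, T i ∈ μ) ∧ ∀ i j, T i ≤ T j → i ≤ j := by
  simp [syt, Fintype.mem_piFinset]

theorem injective_of_mem_syt {μ : YoungDiagram} {n : ℕ} {T : Fin n → ℕ × ℕ} (h : T ∈ μ.syt n) :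
    Function.Injective T := fun i j hij =>
  le_antisymm ((mem_syt.1 h).2 i j hij.le) ((mem_syt.1 h).2 j i hij.ge)

theorem image_of_mem_syt {μ : YoungDiagram} {n : ℕ} (hn : μ.card = n) {T : Fin n → ℕ × ℕ}
    (h : T ∈ μ.syt n) : Finset.univ.image T = μ.cells := by
  apply Finset.eq_of_subset_of_card_le
  · intro x hx
    obtain ⟨i, -, rfl⟩ := Finset.mem_image.1 hx
    exact (mem_syt.1 h).1 i
  · rw [Finset.card_image_of_injective _ (injective_of_mem_syt h), Finset.card_univ,
      Fintype.card_fin]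
    exact hn.le

theorem exists_of_mem_syt {μ : YoungDiagram} {n : ℕ} (hn : μ.card = n) {T : Fin n → ℕ × ℕ}
    (h : T ∈ μ.syt n) {x : ℕ × ℕ} (hx : x ∈ μ) : ∃ i, T i = x := by
  have := image_of_mem_syt hn h
  have hx' : x ∈ Finset.univ.image T := by rw [this]; exact hx
  simpa using hx'

theorem finite_card_eq (n : ℕ) : {μ : YoungDiagram | μ.card = n}.Finite := by
  have hsub : ∀ μ ∈ {μ : YoungDiagram | μ.card = n},
      μ.cells ∈ ((Finset.range n ×ˢ Finset.range n).powerset : Finset (Finset (ℕ × ℕ))) := by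
    intro μ (hμ : μ.card = n)
    rw [Finset.mem_powerset]
    rintro ⟨i, j⟩ hij
    rw [Finset.mem_product, Finset.mem_range, Finset.mem_range]
    constructor
    · have h1 : (Finset.range (i + 1)).image (fun k => (k, j)) ⊆ μ.cells := by
        intro x hx
        obtain ⟨k, hk, rfl⟩ := Finset.mem_image.1 hx
        exact μ.up_left_mem (Nat.lt_succ_iff.1 (Finset.mem_range.1 hk)) le_rfl hij
      have h2 := Finset.card_le_card h1
      rw [Finset.card_image_of_injective _ (fun a b h => (Prod.ext_iff.1 h).1),
        Finset.card_range] at h2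
      change i + 1 ≤ μ.card at h2
      simp only; omega
    · have h1 : (Finset.range (j + 1)).image (fun k => (i, k)) ⊆ μ.cells := by
        intro x hx
        obtain ⟨k, hk, rfl⟩ := Finset.mem_image.1 hx
        exact μ.up_left_mem le_rfl (Nat.lt_succ_iff.1 (Finset.mem_range.1 hk)) hij
      have h2 := Finset.card_le_card h1
      rw [Finset.card_image_of_injective _ (fun a b h => (Prod.ext_iff.1 h).2),
        Finset.card_range] at h2
      change j + 1 ≤ μ.card at h2
      simp only; omega
  refine Set.Finite.of_finite_image (f := YoungDiagram.cells)
    ((Finset.finite_toSet (Finset.range n ×ˢ Finset.range n).powerset).subset ?_) ?_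
  · rintro _ ⟨μ, hμ, rfl⟩
    exact hsub μ hμ
  · intro μ _ ν _ h
    exact YoungDiagram.ext h

/-- The Young diagrams with `n` cells. -/
noncomputable def diagrams (n : ℕ) : Finset YoungDiagram := (finite_card_eq n).toFinset

@[simp] theorem mem_diagrams {n : ℕ} {μ : YoungDiagram} : μ ∈ diagrams n ↔ μ.card = n := by
  simp [diagrams]

/-- The diagrams covered by `μ`. -/
noncomputable def down (μ : YoungDiagram) : Finset YoungDiagram :=
  open Classical in (diagrams (μ.card - 1)).filter fun κ => κ ≤ μ ∧ κ.card + 1 = μ.card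

/-- The diagrams covering `μ`. -/
noncomputable def up (μ : YoungDiagram) : Finset YoungDiagram :=
  open Classical in (diagrams (μ.card + 1)).filter fun ν => μ ≤ ν

theorem mem_down {μ κ : YoungDiagram} : κ ∈ μ.down ↔ κ ≤ μ ∧ κ.card + 1 = μ.card := by
  simp only [down, Finset.mem_filter, mem_diagrams]
  constructor
  · exact fun h => h.2
  · exact fun h => ⟨by omega, h⟩

theorem mem_up {μ ν : YoungDiagram} : ν ∈ μ.up ↔ μ ≤ ν ∧ ν.card = μ.card + 1 := by
  simp [up, and_comm]

theorem mem_down_iff_mem_up {μ ν : YoungDiagram} : μ ∈ ν.down ↔ ν ∈ μ.up := by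
  rw [mem_down, mem_up, eq_comm (a := ν.card)]

theorem card_le_card {μ ν : YoungDiagram} (h : μ ≤ ν) : μ.card ≤ ν.card :=
  Finset.card_le_card (cells_subset_iff.2 h)

theorem eq_of_le_of_card_le {μ ν : YoungDiagram} (h : μ ≤ ν) (hc : ν.card ≤ μ.card) : μ = ν :=
  YoungDiagram.ext (Finset.eq_of_subset_of_card_le (cells_subset_iff.2 h) hc)

theorem card_sup_add_card_inf (μ ν : YoungDiagram) :
    (μ ⊔ ν).card + (μ ⊓ ν).card = μ.card + ν.card := by
  unfold YoungDiagram.card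
  rw [cells_sup, cells_inf, Finset.card_union_add_card_inter]

/-- The diagram of the cells of `μ` that do not dominate `c`. -/
def rem (μ : YoungDiagram) (c : ℕ × ℕ) : YoungDiagram where
  cells := μ.cells.filter fun x => ¬ c ≤ x
  isLowerSet := by
    intro x y hxy hx
    simp only [Finset.coe_filter, Set.mem_ofPred_eq] at hx ⊢
    exact ⟨μ.isLowerSet hxy hx.1, fun h => hx.2 (h.trans hxy)⟩

theorem mem_rem {μ : YoungDiagram} {c x : ℕ × ℕ} : x ∈ μ.rem c ↔ x ∈ μ ∧ ¬ c ≤ x := by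
  rw [← mem_cells, rem, Finset.mem_filter, mem_cells]

/-- The smallest diagram containing `μ` and the cell `c`. -/
def add (μ : YoungDiagram) (c : ℕ × ℕ) : YoungDiagram where
  cells := μ.cells ∪ Finset.Iic c
  isLowerSet := by
    intro x y hxy hx
    simp only [Finset.coe_union, Finset.coe_Iic, Set.mem_union, Set.mem_Iic] at hx ⊢
    exact hx.imp (fun h => μ.isLowerSet hxy h) (fun h => hxy.trans h)

theorem mem_add {μ : YoungDiagram} {c x : ℕ × ℕ} : x ∈ μ.add c ↔ x ∈ μ ∨ x ≤ c := by
  rw [← mem_cells, add, Finset.mem_union, mem_cells, Finset.mem_Iic]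

theorem rem_mem_down {μ : YoungDiagram} {c : ℕ × ℕ} (hc : c ∈ μ)
    (hmax : ∀ x ∈ μ, c ≤ x → x = c) : μ.rem c ∈ μ.down := by
  rw [mem_down]
  refine ⟨fun x hx => (mem_rem.1 hx).1, ?_⟩
  have : (μ.rem c).cells = μ.cells.erase c := by
    ext x
    rw [mem_cells, mem_rem, Finset.mem_erase, mem_cells]
    constructor
    · rintro ⟨h1, h2⟩
      exact ⟨fun h => h2 h.ge, h1⟩
    · rintro ⟨h1, h2⟩
      exact ⟨h2, fun h => h1 (hmax x h2 h)⟩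
  rw [YoungDiagram.card, this]
  exact Finset.card_erase_add_one hc

theorem exists_of_mem_down {μ κ : YoungDiagram} (h : κ ∈ μ.down) :
    ∃ c ∈ μ, (∀ x ∈ μ, c ≤ x → x = c) ∧ κ = μ.rem c := by
  obtain ⟨hle, hcard⟩ := mem_down.1 h
  have hs : (μ.cells \ κ.cells).card = 1 := by
    rw [Finset.card_sdiff_of_subset (cells_subset_iff.2 hle)]
    unfold YoungDiagram.card at hcard
    omega
  obtain ⟨c, hc⟩ := Finset.card_eq_one.1 hs
  have hmem : ∀ x, (x ∈ μ ∧ x ∉ κ) ↔ x = c := by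
    intro x
    rw [← Finset.mem_singleton, ← hc, Finset.mem_sdiff, mem_cells, mem_cells]
  have hcμ := (hmem c).2 rfl
  have hnot : ∀ x, c ≤ x → x ∉ κ := fun x hx hxκ => hcμ.2 (κ.isLowerSet hx hxκ)
  refine ⟨c, hcμ.1, fun x hx hcx => (hmem x).1 ⟨hx, hnot x hcx⟩, ?_⟩
  ext x
  rw [mem_cells, mem_cells, mem_rem]
  constructor
  · exact fun hx => ⟨hle hx, fun hcx => hnot x hcx hx⟩
  · rintro ⟨hx, hcx⟩
    by_contra hxκ
    exact hcx ((hmem x).1 ⟨hx, hxκ⟩).ge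

/-- The rows of `μ` from which a cell can be removed. -/
def remRows (μ : YoungDiagram) : Finset ℕ :=
  (Finset.range (μ.colLen 0)).filter fun i => μ.rowLen (i + 1) < μ.rowLen i

/-- The rows of `μ` to which a cell can be added. -/
def addRows (μ : YoungDiagram) : Finset ℕ :=
  (Finset.range (μ.colLen 0 + 1)).filter fun i => i = 0 ∨ μ.rowLen i < μ.rowLen (i - 1)

/-- Remove the last cell of the `i`-th row. -/
def remRow (μ : YoungDiagram) (i : ℕ) : YoungDiagram := μ.rem (i, μ.rowLen i - 1)

/-- Add a cell to the `i`-th row. -/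
def addRow (μ : YoungDiagram) (i : ℕ) : YoungDiagram := μ.add (i, μ.rowLen i)

theorem rowLen_pos_iff {μ : YoungDiagram} {i : ℕ} : 0 < μ.rowLen i ↔ i < μ.colLen 0 := by
  rw [← mem_iff_lt_rowLen, mem_iff_lt_colLen]

theorem mem_remRows {μ : YoungDiagram} {i : ℕ} :
    i ∈ μ.remRows ↔ μ.rowLen (i + 1) < μ.rowLen i := by
  rw [remRows, Finset.mem_filter, Finset.mem_range, ← rowLen_pos_iff]
  omega

theorem rem_corner_eq {μ : YoungDiagram} {c : ℕ × ℕ} (hc : c ∈ μ)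
    (hmax : ∀ x ∈ μ, c ≤ x → x = c) : c.1 ∈ μ.remRows ∧ c.2 = μ.rowLen c.1 - 1 := by
  obtain ⟨i, j⟩ := c
  have h1 : j < μ.rowLen i := mem_iff_lt_rowLen.1 hc
  have h2 : ¬ j + 1 < μ.rowLen i := fun h => by
    have := hmax (i, j + 1) (mem_iff_lt_rowLen.2 h) (by simp)
    simp at this
  have h3 : ¬ j < μ.rowLen (i + 1) := fun h => by
    have := hmax (i + 1, j) (mem_iff_lt_rowLen.2 h) (by simp)
    simp at this
  rw [mem_remRows]
  simp only
  omega

theorem corner_of_mem_remRows {μ : YoungDiagram} {i : ℕ} (hi : i ∈ μ.remRows) :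
    (i, μ.rowLen i - 1) ∈ μ ∧ ∀ x ∈ μ, (i, μ.rowLen i - 1) ≤ x → x = (i, μ.rowLen i - 1) := by
  rw [mem_remRows] at hi
  refine ⟨mem_iff_lt_rowLen.2 (by omega), ?_⟩
  rintro ⟨k, l⟩ hx ⟨h1, h2⟩
  simp only at h1 h2
  have h3 := mem_iff_lt_rowLen.1 hx
  rcases h1.eq_or_lt with rfl | h
  · ext <;> simp; omega
  · have := μ.rowLen_anti (i + 1) k h
    omega

theorem down_eq_image (μ : YoungDiagram) : μ.down = μ.remRows.image μ.remRow := by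
  ext κ
  rw [Finset.mem_image]
  constructor
  · intro h
    obtain ⟨c, hc, hmax, rfl⟩ := exists_of_mem_down h
    obtain ⟨h1, h2⟩ := rem_corner_eq hc hmax
    exact ⟨c.1, h1, by rw [remRow, ← h2]⟩
  · rintro ⟨i, hi, rfl⟩
    exact rem_mem_down (corner_of_mem_remRows hi).1 (corner_of_mem_remRows hi).2

theorem rowLen_remRow {μ : YoungDiagram} {i : ℕ} (hi : i ∈ μ.remRows) (k : ℕ) :
    (μ.remRow i).rowLen k = if k = i then μ.rowLen i - 1 else μ.rowLen k := by
  rw [mem_remRows] at hi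
  apply eq_of_forall_lt_iff
  intro j
  rw [← mem_iff_lt_rowLen, remRow, mem_rem, mem_iff_lt_rowLen, Prod.mk_le_mk]
  split_ifs with h
  · subst h; omega
  · rcases lt_or_gt_of_ne h with h' | h'
    · omega
    · have := μ.rowLen_anti (i + 1) k h'
      omega

theorem injOn_remRow (μ : YoungDiagram) : Set.InjOn μ.remRow μ.remRows := by
  intro i hi j hj h
  by_contra hij
  have h1 := rowLen_remRow hi i
  rw [h, rowLen_remRow hj i, if_neg hij, if_pos rfl] at h1
  have := mem_remRows.1 hi
  omega

theorem sum_down {M : Type*} [AddCommMonoid M] (μ : YoungDiagram) (g : YoungDiagram → M) :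
    ∑ κ ∈ μ.down, g κ = ∑ i ∈ μ.remRows, g (μ.remRow i) := by
  rw [down_eq_image, Finset.sum_image μ.injOn_remRow]

theorem addCell_spec {μ : YoungDiagram} {i : ℕ} (hi : i ∈ μ.addRows) {x : ℕ × ℕ}
    (hx : x ≤ (i, μ.rowLen i)) (hne : x ≠ (i, μ.rowLen i)) : x ∈ μ := by
  obtain ⟨k, l⟩ := x
  obtain ⟨h1, h2⟩ := hx
  simp only at h1 h2
  rw [mem_iff_lt_rowLen]
  rcases h1.eq_or_lt with rfl | h
  · have : l ≠ μ.rowLen k := fun h => hne (by rw [h])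
    omega
  · rw [addRows, Finset.mem_filter] at hi
    have := μ.rowLen_anti k (i - 1) (by omega)
    omega

theorem addRow_cells {μ : YoungDiagram} {i : ℕ} (hi : i ∈ μ.addRows) :
    (μ.addRow i).cells = insert (i, μ.rowLen i) μ.cells := by
  ext x
  rw [mem_cells, addRow, mem_add, Finset.mem_insert, mem_cells]
  constructor
  · rintro (h | h)
    · exact Or.inr h
    · by_cases hx : x = (i, μ.rowLen i)
      · exact Or.inl hx
      · exact Or.inr (addCell_spec hi h hx)
  · rintro (rfl | h)
    · exact Or.inr le_rfl
    · exact Or.inl h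

theorem up_eq_image (μ : YoungDiagram) : μ.up = μ.addRows.image μ.addRow := by
  ext ν
  rw [Finset.mem_image]
  constructor
  · intro h
    obtain ⟨c, hc, hmax, rfl⟩ := exists_of_mem_down (mem_down_iff_mem_up.2 h)
    obtain ⟨i, j⟩ := c
    have hnotmem : (i, j) ∉ ν.rem (i, j) := fun h => (mem_rem.1 h).2 le_rfl
    have hmem : ∀ x, x ≤ (i, j) → x ≠ (i, j) → x ∈ ν.rem (i, j) := fun x hx hne =>
      mem_rem.2 ⟨ν.isLowerSet hx hc, fun h => hne (le_antisymm hx h)⟩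
    have hj : (ν.rem (i, j)).rowLen i = j := by
      apply le_antisymm
      · exact not_lt.1 fun h => hnotmem (mem_iff_lt_rowLen.2 h)
      · rcases j with _ | j
        · simp
        · exact mem_iff_lt_rowLen.1 (hmem (i, j) (by simp) (by simp))
    have hi : i ∈ (ν.rem (i, j)).addRows := by
      rw [addRows, Finset.mem_filter, Finset.mem_range, hj]
      rcases i with _ | i
      · simp
      · have h1 := hmem (i, j) (by simp) (by simp)
        have h2 : (i, 0) ∈ ν.rem (i + 1, j) := (ν.rem (i + 1, j)).up_left_mem le_rfl (Nat.zero_le _) h1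
        refine ⟨Nat.succ_lt_succ (mem_iff_lt_colLen.1 h2), Or.inr ?_⟩
        simpa using mem_iff_lt_rowLen.1 h1
    refine ⟨i, hi, ?_⟩
    apply YoungDiagram.ext
    rw [addRow_cells hi, hj]
    ext x
    rw [Finset.mem_insert, mem_cells, mem_cells, mem_rem]
    constructor
    · rintro (rfl | h)
      · exact hc
      · exact h.1
    · intro hx
      by_cases hcx : (i, j) ≤ x
      · exact Or.inl (hmax x hx hcx)
      · exact Or.inr ⟨hx, hcx⟩
  · rintro ⟨i, hi, rfl⟩
    rw [mem_up]
    refine ⟨fun x hx => mem_add.2 (Or.inl hx), ?_⟩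
    rw [YoungDiagram.card, addRow_cells hi, Finset.card_insert_of_notMem]
    rw [mem_cells, mem_iff_lt_rowLen]
    exact lt_irrefl _

theorem injOn_addRow (μ : YoungDiagram) : Set.InjOn μ.addRow μ.addRows := by
  intro i hi j hj h
  have h1 : (i, μ.rowLen i) ∈ (μ.addRow j).cells := by
    rw [← h, addRow_cells hi]
    exact Finset.mem_insert_self _ _
  rw [addRow_cells hj, Finset.mem_insert, mem_cells, mem_iff_lt_rowLen] at h1
  rcases h1 with h1 | h1
  · exact (Prod.ext_iff.1 h1).1
  · exact absurd h1 (lt_irrefl _)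

theorem card_up (μ : YoungDiagram) : μ.up.card = μ.down.card + 1 := by
  rw [up_eq_image, down_eq_image, Finset.card_image_of_injOn μ.injOn_remRow,
    Finset.card_image_of_injOn μ.injOn_addRow]
  have : μ.addRows = insert 0 (μ.remRows.image Nat.succ) := by
    ext i
    rw [Finset.mem_insert, Finset.mem_image, addRows, Finset.mem_filter, Finset.mem_range]
    rcases i with _ | i
    · simp
    · have : (∃ a ∈ μ.remRows, a.succ = i + 1) ↔ i ∈ μ.remRows := by simp
      rw [this, remRows, Finset.mem_filter, Finset.mem_range]
      simp
  rw [this, Finset.card_insert_of_notMem (by simp),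
    Finset.card_image_of_injective _ Nat.succ_injective]

theorem numSYT_bot : (⊥ : YoungDiagram).numSYT = 1 := by
  have h : (⊥ : YoungDiagram).card = 0 := rfl
  rw [numSYT, h, Finset.card_eq_one]
  refine ⟨Fin.elim0, ?_⟩
  ext T
  rw [mem_syt, Finset.mem_singleton]
  exact ⟨fun _ => Subsingleton.elim _ _, fun _ => ⟨fun i => i.elim0, fun i => i.elim0⟩⟩

theorem last_corner {μ : YoungDiagram} {n : ℕ} (hn : μ.card = n + 1) {T : Fin (n + 1) → ℕ × ℕ}
    (h : T ∈ μ.syt (n + 1)) : ∀ x ∈ μ, T (Fin.last n) ≤ x → x = T (Fin.last n) := by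
  intro x hx hle
  obtain ⟨i, rfl⟩ := exists_of_mem_syt hn h hx
  rw [le_antisymm (Fin.le_last i) ((mem_syt.1 h).2 _ _ hle)]

/-- The branching rule for standard Young tableaux. -/
theorem numSYT_eq_sum {μ : YoungDiagram} {n : ℕ} (hn : μ.card = n + 1) :
    μ.numSYT = ∑ κ ∈ μ.down, κ.numSYT := by
  classical
  rw [numSYT, hn, Finset.card_eq_sum_card_fiberwise
    (f := fun T : Fin (n + 1) → ℕ × ℕ => μ.rem (T (Fin.last n))) (t := μ.down)]
  · refine Finset.sum_congr rfl fun κ hκ => ?_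
    obtain ⟨c, hc, hmax, rfl⟩ := exists_of_mem_down hκ
    have hcard : (μ.rem c).card = n := by
      have := (mem_down.1 hκ).2
      omega
    rw [numSYT, hcard]
    have hlast : ∀ T ∈ (μ.syt (n + 1)).filter (fun T => μ.rem (T (Fin.last n)) = μ.rem c),
        T (Fin.last n) = c := by
      intro T hT
      obtain ⟨hT, he⟩ := Finset.mem_filter.1 hT
      have h1 : c ∉ μ.rem (T (Fin.last n)) := by
        rw [he]
        exact fun h => (mem_rem.1 h).2 le_rfl
      rw [mem_rem, not_and_not_right] at h1
      exact (last_corner hn hT c hc (h1 hc)).symm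
    refine Finset.card_bij' (fun T _ => Fin.init T) (fun S _ => Fin.snoc S c) ?_ ?_ ?_ ?_
    · intro T hT
      have hl := hlast T hT
      have hT := (Finset.mem_filter.1 hT).1
      rw [mem_syt]
      refine ⟨fun i => mem_rem.2 ⟨(mem_syt.1 hT).1 _, fun h => ?_⟩, fun i j h => ?_⟩
      · rw [← hl] at h
        exact absurd ((mem_syt.1 hT).2 _ _ h) (not_le.2 (Fin.castSucc_lt_last i))
      · exact Fin.castSucc_le_castSucc_iff.1 ((mem_syt.1 hT).2 _ _ h)
    · intro S hS
      rw [Finset.mem_filter, mem_syt]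
      refine ⟨⟨fun i => ?_, fun i j => ?_⟩, by simp⟩
      · refine Fin.lastCases ?_ (fun i => ?_) i
        · simpa using hc
        · simpa using (mem_rem.1 ((mem_syt.1 hS).1 i)).1
      · refine Fin.lastCases ?_ (fun j => ?_) j
        · exact fun _ => Fin.le_last _
        · refine Fin.lastCases ?_ (fun i => ?_) i
          · intro h
            simp only [Fin.snoc_last, Fin.snoc_castSucc] at h
            exact absurd h (mem_rem.1 ((mem_syt.1 hS).1 j)).2
          · intro h
            simp only [Fin.snoc_castSucc] at h
            exact Fin.castSucc_le_castSucc_iff.2 ((mem_syt.1 hS).2 i j h)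
    · intro T hT
      rw [← hlast T hT]
      exact Fin.snoc_init_self T
    · intro S hS
      exact Fin.init_snoc _ _
  · intro T hT
    exact rem_mem_down ((mem_syt.1 hT).1 _) (last_corner hn hT)

theorem numSYT_eq_sum_remRows {μ : YoungDiagram} {n : ℕ} (hn : μ.card = n + 1) :
    μ.numSYT = ∑ i ∈ μ.remRows, (μ.remRow i).numSYT := by
  rw [numSYT_eq_sum hn, sum_down]

theorem sum_up_numSYT (n : ℕ) : ∀ μ : YoungDiagram, μ.card = n →
    ∑ ν ∈ μ.up, ν.numSYT = (n + 1) * μ.numSYT := by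
  classical
  induction n using Nat.strong_induction_on with
  | _ n ih =>
  intro μ hμ
  have h1 : ∑ ν ∈ μ.up, ν.numSYT
      = μ.up.card * μ.numSYT + ∑ ν ∈ μ.up, ∑ κ ∈ ν.down.erase μ, κ.numSYT := by
    rw [← smul_eq_mul, ← Finset.sum_const, ← Finset.sum_add_distrib]
    refine Finset.sum_congr rfl fun ν hν => ?_
    rw [numSYT_eq_sum (by rw [(mem_up.1 hν).2]), Finset.add_sum_erase]
    exact mem_down_iff_mem_up.2 hν
  have h2 : n * μ.numSYT
      = μ.down.card * μ.numSYT + ∑ κ ∈ μ.down, ∑ ν ∈ κ.up.erase μ, ν.numSYT := by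
    have : n * μ.numSYT = ∑ κ ∈ μ.down, n * κ.numSYT := by
      rcases n with _ | n
      · simp
      · rw [numSYT_eq_sum hμ, Finset.mul_sum]
    rw [this, ← smul_eq_mul, ← Finset.sum_const, ← Finset.sum_add_distrib]
    refine Finset.sum_congr rfl fun κ hκ => ?_
    have hc := (mem_down.1 hκ).2
    rw [Finset.add_sum_erase _ _ (mem_down_iff_mem_up.1 hκ), ih κ.card (by omega) κ rfl, hc, hμ]
  have h3 : ∑ ν ∈ μ.up, ∑ κ ∈ ν.down.erase μ, κ.numSYT
      = ∑ κ ∈ μ.down, ∑ ν ∈ κ.up.erase μ, ν.numSYT := by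
    rw [Finset.sum_sigma', Finset.sum_sigma']
    refine Finset.sum_bij' (fun p _ => ⟨μ ⊓ p.2, p.2⟩) (fun p _ => ⟨μ ⊔ p.2, p.2⟩) ?_ ?_ ?_ ?_ ?_
    · rintro ⟨ν, κ⟩ h
      simp only [Finset.mem_sigma, Finset.mem_erase, mem_up, mem_down] at h ⊢
      obtain ⟨⟨a, b⟩, c, d, e⟩ := h
      have h4 := card_sup_add_card_inf μ κ
      have h5 := card_le_card (sup_le a d)
      have h6 : (μ ⊓ κ).card < κ.card := by
        by_contra h7
        have h8 := eq_of_le_of_card_le (inf_le_right : μ ⊓ κ ≤ κ) (not_lt.1 h7)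
        exact c (eq_of_le_of_card_le (inf_eq_right.1 h8) (by omega))
      exact ⟨⟨inf_le_left, by omega⟩, c, inf_le_right, by omega⟩
    · rintro ⟨κ, ν⟩ h
      simp only [Finset.mem_sigma, Finset.mem_erase, mem_up, mem_down] at h ⊢
      obtain ⟨⟨a, b⟩, c, d, e⟩ := h
      have h4 := card_sup_add_card_inf μ ν
      have h5 := card_le_card (le_inf a d)
      have h6 : ν.card < (μ ⊔ ν).card := by
        by_contra h7
        have h8 := eq_of_le_of_card_le (le_sup_right : ν ≤ μ ⊔ ν) (not_lt.1 h7)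
        exact c (eq_of_le_of_card_le (right_eq_sup.1 h8) (by omega)).symm
      exact ⟨⟨le_sup_left, by omega⟩, c, le_sup_right, by omega⟩
    · rintro ⟨ν, κ⟩ h
      simp only [Finset.mem_sigma, Finset.mem_erase, mem_up, mem_down] at h
      obtain ⟨⟨a, b⟩, c, d, e⟩ := h
      have h6 : μ.card < (μ ⊔ κ).card := by
        by_contra h7
        have h8 := eq_of_le_of_card_le (le_sup_left : μ ≤ μ ⊔ κ) (not_lt.1 h7)
        exact c (eq_of_le_of_card_le (left_eq_sup.1 h8) (by omega))
      have : μ ⊔ κ = ν := eq_of_le_of_card_le (sup_le a d) (by omega)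
      simp [this]
    · rintro ⟨κ, ν⟩ h
      simp only [Finset.mem_sigma, Finset.mem_erase, mem_up, mem_down] at h
      obtain ⟨⟨a, b⟩, c, d, e⟩ := h
      have h6 : (μ ⊓ ν).card < μ.card := by
        by_contra h7
        have h8 := eq_of_le_of_card_le (inf_le_left : μ ⊓ ν ≤ μ) (not_lt.1 h7)
        exact c (eq_of_le_of_card_le (inf_eq_left.1 h8) (by omega)).symm
      have : κ = μ ⊓ ν := eq_of_le_of_card_le (le_inf a d) (by omega)
      simp [← this]
    · rintro ⟨ν, κ⟩ h
      rfl
  rw [h1, h3, card_up, add_mul, add_mul, h2]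
  ring

/-- The sum of the squares of the numbers of standard Young tableaux with `n` cells is `n!`. -/
theorem sum_numSYT_sq (n : ℕ) : ∑ μ ∈ diagrams n, μ.numSYT ^ 2 = n.factorial := by
  classical
  induction n with
  | zero =>
    have : diagrams 0 = {⊥} := by
      ext μ
      rw [mem_diagrams, Finset.mem_singleton]
      constructor
      · intro h
        exact (eq_of_le_of_card_le bot_le (by rw [h]; exact Nat.zero_le _)).symm
      · rintro rfl; rfl
    rw [this, Finset.sum_singleton, numSYT_bot]
    rfl
  | succ n ih =>
    have h1 : ∀ μ ∈ diagrams (n + 1), μ.numSYT ^ 2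
        = ∑ κ ∈ diagrams n, if κ ≤ μ then μ.numSYT * κ.numSYT else 0 := by
      intro μ hμ
      rw [mem_diagrams] at hμ
      rw [← Finset.sum_filter, ← Finset.mul_sum, sq]
      conv_lhs => rw [numSYT_eq_sum hμ]
      rw [← numSYT_eq_sum hμ]
      congr 1
      rw [numSYT_eq_sum hμ]
      refine Finset.sum_congr ?_ fun _ _ => rfl
      ext κ
      rw [mem_down, Finset.mem_filter, mem_diagrams, hμ]
      constructor
      · rintro ⟨a, b⟩; exact ⟨by omega, a⟩
      · rintro ⟨a, b⟩; exact ⟨b, by omega⟩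
    rw [Finset.sum_congr rfl h1, Finset.sum_comm, Nat.factorial_succ, ← ih, Finset.mul_sum]
    refine Finset.sum_congr rfl fun κ hκ => ?_
    rw [mem_diagrams] at hκ
    rw [← Finset.sum_filter, ← Finset.sum_mul, sq, ← mul_assoc, ← sum_up_numSYT n κ hκ]
    congr 1
    refine Finset.sum_congr ?_ fun _ _ => rfl
    ext μ
    rw [mem_up, Finset.mem_filter, mem_diagrams, hκ, and_comm]

end YoungDiagram

namespace CoxeterTypeA

section
variable {H : Type*} [Group H]

/-- The product `t k * t (k + 1) * ⋯ * t (k + d - 1)`. -/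
def ascProd (t : ℕ → H) : ℕ → ℕ → H
  | _, 0 => 1
  | k, d + 1 => t k * ascProd t (k + 1) d

theorem mul_ascProd_of_comm (t : ℕ → H) (x : H) : ∀ d k,
    (∀ j, k ≤ j → j < k + d → x * t j = t j * x) → x * ascProd t k d = ascProd t k d * x
  | 0, k, _ => by simp [ascProd]
  | d + 1, k, h => by
    have ih := mul_ascProd_of_comm t x d (k + 1) fun j h1 h2 => h j (by omega) (by omega)
    rw [ascProd, ← mul_assoc, h k le_rfl (by omega), mul_assoc, ih, mul_assoc]

/-- The relations between the simple reflections in type `A_m`. -/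
structure Rels (t : ℕ → H) (m : ℕ) : Prop where
  sq : ∀ i, i < m → t i * t i = 1
  braid : ∀ i, i + 1 < m → t i * t (i + 1) * t i = t (i + 1) * t i * t (i + 1)
  comm : ∀ i j, i + 1 < j → j < m → t i * t j = t j * t i

theorem Rels.mono {t : ℕ → H} {m m' : ℕ} (h : Rels t m) (hm : m' ≤ m) : Rels t m' :=
  ⟨fun i hi => h.sq i (by omega), fun i hi => h.braid i (by omega),
    fun i j hij hj => h.comm i j hij (by omega)⟩

theorem Rels.mul_ascProd {t : ℕ → H} {m : ℕ} (h : Rels t m) : ∀ d k i,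
    k ≤ i → i + 1 < k + d → k + d ≤ m → t (i + 1) * ascProd t k d = ascProd t k d * t i
  | 0, k, i, h1, h2, _ => by omega
  | 1, k, i, h1, h2, _ => by omega
  | d + 2, k, i, h1, h2, h3 => by
    rcases h1.eq_or_lt with rfl | hlt
    · have hc : t k * ascProd t (k + 2) d = ascProd t (k + 2) d * t k :=
        mul_ascProd_of_comm t _ d _ fun j h4 h5 => h.comm k j (by omega) (by omega)
      calc t (k + 1) * ascProd t k (d + 2)
          = (t (k + 1) * t k * t (k + 1)) * ascProd t (k + 2) d := by
            simp only [ascProd, mul_assoc]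
        _ = t k * t (k + 1) * (t k * ascProd t (k + 2) d) := by
            rw [← h.braid k (by omega)]; simp only [mul_assoc]
        _ = ascProd t k (d + 2) * t k := by
            rw [hc]; simp only [ascProd, mul_assoc]
    · have ih := h.mul_ascProd (d + 1) (k + 1) i (by omega) (by omega) (by omega)
      rw [ascProd, ← mul_assoc, ← h.comm k (i + 1) (by omega) (by omega), mul_assoc, ih, mul_assoc]

theorem Rels.exists_finset {t : ℕ → H} : ∀ {m : ℕ}, Rels t m → ∃ S : Finset H,
    1 ∈ S ∧ S.card ≤ (m + 1).factorial ∧ ∀ i < m, ∀ s ∈ S, t i * s ∈ S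
  | 0, _ => ⟨{1}, by simp⟩
  | m + 1, h => by
    classical
    obtain ⟨S, h1, hcard, hS⟩ := Rels.exists_finset (h.mono m.le_succ)
    refine ⟨(Finset.range (m + 2) ×ˢ S).image fun p => ascProd t p.1 (m + 1 - p.1) * p.2,
      ?_, ?_, ?_⟩
    · refine Finset.mem_image.2 ⟨(m + 1, 1), by simp [h1], by simp [ascProd]⟩
    · refine Finset.card_image_le.trans ?_
      rw [Finset.card_product, Finset.card_range, Nat.factorial_succ (m + 1)]
      exact Nat.mul_le_mul_left _ hcard
    · intro i hi x hx
      obtain ⟨⟨k, s⟩, hks, rfl⟩ := Finset.mem_image.1 hx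
      rw [Finset.mem_product, Finset.mem_range] at hks
      obtain ⟨hk, hs⟩ := hks
      simp only at hk hs ⊢
      suffices ∃ k' s', k' < m + 2 ∧ s' ∈ S ∧
          ascProd t k' (m + 1 - k') * s' = t i * (ascProd t k (m + 1 - k) * s) by
        obtain ⟨k', s', a, b, c⟩ := this
        exact Finset.mem_image.2 ⟨(k', s'), by simp [a, b], c⟩
      rcases lt_trichotomy (i + 1) k with hik | hik | hik
      · refine ⟨k, t i * s, hk, hS i (by omega) s hs, ?_⟩
        rw [← mul_assoc, ← mul_assoc, mul_ascProd_of_comm]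
        exact fun j h4 h5 => h.comm i j (by omega) (by omega)
      · subst hik
        refine ⟨i, s, by omega, hs, ?_⟩
        rw [show m + 1 - i = (m + 1 - (i + 1)) + 1 by omega, ascProd, mul_assoc]
      · rcases (Nat.lt_succ_iff.1 hik).eq_or_lt with rfl | hki
        · refine ⟨k + 1, s, by omega, hs, ?_⟩
          rw [show m + 1 - k = (m + 1 - (k + 1)) + 1 by omega, ascProd, ← mul_assoc, ← mul_assoc,
            h.sq k (by omega), one_mul]
        · obtain ⟨i, rfl⟩ : ∃ j, i = j + 1 := ⟨i - 1, by omega⟩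
          refine ⟨k, t i * s, hk, hS i (by omega) s hs, ?_⟩
          rw [← mul_assoc, ← mul_assoc,
            h.mul_ascProd (m + 1 - k) k i (by omega) (by omega) (by omega)]

end

/-- The adjacent transposition `(i, i + 1)`, as a permutation of `Fin (m + 1)`. -/
def adjSwap (m i : ℕ) : Equiv.Perm (Fin (m + 1)) :=
  if h : i < m then Equiv.swap (Fin.castSucc ⟨i, h⟩) (Fin.succ ⟨i, h⟩) else 1

theorem adjSwap_coe {m : ℕ} (i : Fin m) : adjSwap m i = Equiv.swap i.castSucc i.succ := by
  simp [adjSwap]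

theorem swap_braid {α : Type*} [DecidableEq α] {a b c : α} (hab : a ≠ b) (hac : a ≠ c)
    (hbc : b ≠ c) : Equiv.swap a b * Equiv.swap b c * Equiv.swap a b
      = Equiv.swap b c * Equiv.swap a b * Equiv.swap b c := by
  rw [Equiv.swap_mul_swap_mul_swap hab hac, Equiv.swap_comm a b, Equiv.swap_comm b c,
    Equiv.swap_mul_swap_mul_swap hbc.symm hac.symm, Equiv.swap_comm]

theorem rels_adjSwap (m : ℕ) : Rels (adjSwap m) m where
  sq i hi := by simp [adjSwap, hi]
  braid i hi := by
    have h1 : i < m := by omega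
    simp only [adjSwap, hi, h1, dif_pos]
    exact swap_braid (by simp [Fin.ext_iff]) (by simp [Fin.ext_iff]; omega) (by simp [Fin.ext_iff])
  comm i j hij hj := by
    have h1 : i < m := by omega
    simp only [adjSwap, hj, h1, dif_pos]
    refine (Equiv.Perm.disjoint_swap_swap ?_).commute
    simp [Fin.ext_iff]
    omega

theorem closure_adjSwap (m : ℕ) :
    Subgroup.closure {x | ∃ i < m, x = adjSwap m i} = ⊤ := by
  rw [eq_top_iff]
  intro x _
  have h1 : x ∈ Submonoid.closure (Set.range fun i : Fin m => Equiv.swap i.castSucc i.succ) := by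
    rw [Equiv.Perm.mclosure_swap_castSucc_succ]; trivial
  refine (Submonoid.closure_le (S := (Subgroup.closure _).toSubmonoid)).2 ?_ h1
  rintro _ ⟨i, rfl⟩
  exact Subgroup.subset_closure ⟨i, i.2, (adjSwap_coe i).symm⟩

/-- A family of elements of a group that satisfies the relations of type `A_m` defines a
homomorphism from the symmetric group. -/
theorem Rels.exists_hom {H : Type*} [Group H] {t : ℕ → H} {m : ℕ} (h : Rels t m) :
    ∃ φ : Equiv.Perm (Fin (m + 1)) →* H, ∀ i < m, φ (adjSwap m i) = t i := by
  classical
  have hp : Rels (fun i => (t i, adjSwap m i)) m :=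
    ⟨fun i hi => Prod.ext (h.sq i hi) ((rels_adjSwap m).sq i hi),
      fun i hi => Prod.ext (h.braid i hi) ((rels_adjSwap m).braid i hi),
      fun i j hi hj => Prod.ext (h.comm i j hi hj) ((rels_adjSwap m).comm i j hi hj)⟩
  obtain ⟨S, h1, hcard, hS⟩ := hp.exists_finset
  let K := Subgroup.closure {x | ∃ i < m, x = (t i, adjSwap m i)}
  have hK : (K : Set (H × Equiv.Perm (Fin (m + 1)))) ⊆ S := by
    intro x hx
    induction hx using Subgroup.closure_induction_left with
    | one => exact h1
    | mul_left x hx y _ hy =>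
      obtain ⟨i, hi, rfl⟩ := hx
      exact hS i hi y hy
    | inv_mul_cancel x hx y _ hy =>
      obtain ⟨i, hi, rfl⟩ := hx
      rw [inv_eq_of_mul_eq_one_left (hp.sq i hi)]
      exact hS i hi y hy
  let p : K →* Equiv.Perm (Fin (m + 1)) := (MonoidHom.snd _ _).comp K.subtype
  have hmem : ∀ i < m, (t i, adjSwap m i) ∈ K := fun i hi =>
    Subgroup.subset_closure ⟨i, hi, rfl⟩
  have hsurj : Function.Surjective p := by
    rw [← MonoidHom.range_eq_top, eq_top_iff, ← closure_adjSwap, Subgroup.closure_le]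
    rintro _ ⟨i, hi, rfl⟩
    exact ⟨⟨_, hmem i hi⟩, rfl⟩
  have hfin : Finite K := (S.finite_toSet.subset hK).to_subtype
  have hle : Nat.card K ≤ Nat.card (Equiv.Perm (Fin (m + 1))) := by
    rw [Nat.card_perm, Nat.card_fin]
    refine le_trans ?_ hcard
    exact (Nat.card_mono S.finite_toSet hK).trans (by simp)
  have hbij : Function.Bijective p := by
    refine (Nat.bijective_iff_surjective_and_card p).2 ⟨hsurj, ?_⟩
    exact le_antisymm hle (Nat.card_le_card_of_surjective p hsurj)
  let e := MulEquiv.ofBijective p hbij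
  refine ⟨((MonoidHom.fst _ _).comp K.subtype).comp e.symm.toMonoidHom, fun i hi => ?_⟩
  have : e.symm (adjSwap m i) = ⟨_, hmem i hi⟩ := by
    rw [MulEquiv.symm_apply_eq]; rfl
  simp [this]

end CoxeterTypeA

namespace YoungDiagram

/-- The content of a cell. -/
def content (c : ℕ × ℕ) : ℤ := c.2 - c.1

theorem content_zero : content (0, 0) = 0 := rfl

/-- The diagonal coefficient of Young's orthogonal form. -/
noncomputable def ortA (c d : ℕ × ℕ) : ℝ := ((content d - content c : ℤ) : ℝ)⁻¹

/-- The off-diagonal coefficient of Young's orthogonal form. -/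
noncomputable def ortB (c d : ℕ × ℕ) : ℝ := √(1 - ortA c d ^ 2)

theorem ortA_comm (c d : ℕ × ℕ) : ortA d c = -ortA c d := by
  rw [ortA, ortA, ← inv_neg]
  push_cast
  ring

theorem ortB_comm (c d : ℕ × ℕ) : ortB d c = ortB c d := by
  rw [ortB, ortB, ortA_comm, neg_sq]

theorem ortA_sq_le_one (c d : ℕ × ℕ) : ortA c d ^ 2 ≤ 1 := by
  rw [ortA, sq_le_one_iff_abs_le_one, abs_inv]
  rcases eq_or_ne (content d - content c) 0 with h | h
  · simp [h]
  · apply inv_le_one_of_one_le₀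
    exact_mod_cast Int.one_le_abs h

theorem ortB_sq (c d : ℕ × ℕ) : ortB c d ^ 2 = 1 - ortA c d ^ 2 :=
  Real.sq_sqrt (sub_nonneg.2 (ortA_sq_le_one c d))

theorem ortB_eq_zero {c d : ℕ × ℕ} (h : |content d - content c| = 1) : ortB c d = 0 := by
  have h1 : ortA c d ^ 2 = 1 := by
    rw [ortA, inv_pow, ← sq_abs, ← Int.cast_abs, h]
    norm_num
  rw [ortB, h1, sub_self, Real.sqrt_zero]

theorem ortB_ne_zero {c d : ℕ × ℕ} (h : |content d - content c| ≠ 1) : ortB c d ≠ 0 := by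
  rw [ortB, Real.sqrt_ne_zero', sub_pos, ortA, sq_lt_one_iff_abs_lt_one, abs_inv]
  rcases eq_or_ne (content d - content c) 0 with h0 | h0
  · simp [h0]
  · apply inv_lt_one_of_one_lt₀
    have h1 := Int.one_le_abs h0
    have h2 : 1 < |content d - content c| := lt_of_le_of_ne h1 h.symm
    exact_mod_cast h2

theorem ortA_mul_sub {c d : ℕ × ℕ} (h : content c ≠ content d) :
    ortA c d * ((content d : ℝ) - content c) = 1 := by
  have : ((content d : ℝ) - content c) ≠ 0 := by
    rw [sub_ne_zero]
    exact_mod_cast h.symm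
  rw [ortA]
  push_cast
  exact inv_mul_cancel₀ this

theorem ortA_mul_ortA {c d e : ℕ × ℕ} (h1 : content c ≠ content d) (h2 : content d ≠ content e)
    (h3 : content c ≠ content e) :
    ortA c d * ortA d e = ortA c e * (ortA c d + ortA d e) := by
  have a1 : ((content d : ℝ) - content c) ≠ 0 := by
    rw [sub_ne_zero]; exact_mod_cast h1.symm
  have a2 : ((content e : ℝ) - content d) ≠ 0 := by
    rw [sub_ne_zero]; exact_mod_cast h2.symm
  have a3 : ((content e : ℝ) - content c) ≠ 0 := by
    rw [sub_ne_zero]; exact_mod_cast h3.symm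
  rw [ortA, ortA, ortA]
  push_cast
  field_simp
  ring

section op

variable {n : ℕ}

/-- Young's orthogonal operator attached to the transposition of two entries, on functions on all
fillings. -/
noncomputable def op (p q : Fin n) (G : (Fin n → ℕ × ℕ) → ℂ) (T : Fin n → ℕ × ℕ) : ℂ :=
  (ortA (T p) (T q) : ℂ) * G T + (ortB (T p) (T q) : ℂ) * G (T ∘ Equiv.swap p q)

theorem ortB_sq_complex (c d : ℕ × ℕ) : (ortB c d : ℂ) ^ 2 = 1 - (ortA c d : ℂ) ^ 2 := by
  exact_mod_cast congrArg ((↑) : ℝ → ℂ) (ortB_sq c d)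

theorem comp_swap_comp_swap (p q : Fin n) (T : Fin n → ℕ × ℕ) :
    (T ∘ Equiv.swap p q) ∘ Equiv.swap p q = T := by
  funext x
  simp

theorem op_op (p q : Fin n) (G : (Fin n → ℕ × ℕ) → ℂ) (T : Fin n → ℕ × ℕ) :
    op p q (op p q G) T = G T := by
  simp only [op, Function.comp_apply, Equiv.swap_apply_left, Equiv.swap_apply_right,
    comp_swap_comp_swap, ortA_comm (T p) (T q), ortB_comm (T p) (T q)]
  push_cast
  linear_combination G T * ortB_sq_complex (T p) (T q)

theorem op_comm {p q r s : Fin n} (hpr : p ≠ r) (hps : p ≠ s) (hqr : q ≠ r) (hqs : q ≠ s)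
    (G : (Fin n → ℕ × ℕ) → ℂ) (T : Fin n → ℕ × ℕ) :
    op p q (op r s G) T = op r s (op p q G) T := by
  have h : (T ∘ Equiv.swap p q) ∘ Equiv.swap r s = (T ∘ Equiv.swap r s) ∘ Equiv.swap p q := by
    have h1 : Equiv.swap p q * Equiv.swap r s = Equiv.swap r s * Equiv.swap p q := by
      rcases eq_or_ne p q with rfl | h1
      · rw [Equiv.swap_self]; rfl
      rcases eq_or_ne r s with rfl | h2
      · rw [Equiv.swap_self]; rfl
      refine (Equiv.Perm.disjoint_swap_swap ?_).commute
      simp_all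
    funext x
    exact congrArg T (Equiv.congr_fun h1 x)
  simp only [op, Function.comp_apply, h, Equiv.swap_apply_of_ne_of_ne hpr hps,
    Equiv.swap_apply_of_ne_of_ne hqr hqs, Equiv.swap_apply_of_ne_of_ne hpr.symm hqr.symm,
    Equiv.swap_apply_of_ne_of_ne hps.symm hqs.symm]
  ring

theorem op_braid {p q r : Fin n} (hpq : p ≠ q) (hpr : p ≠ r) (hqr : q ≠ r)
    (G : (Fin n → ℕ × ℕ) → ℂ) {T : Fin n → ℕ × ℕ} (h1 : content (T p) ≠ content (T q))
    (h2 : content (T q) ≠ content (T r)) (h3 : content (T p) ≠ content (T r)) :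
    op p q (op q r (op p q G)) T = op q r (op p q (op q r G)) T := by
  have h : ((T ∘ Equiv.swap p q) ∘ Equiv.swap q r) ∘ Equiv.swap p q
      = ((T ∘ Equiv.swap q r) ∘ Equiv.swap p q) ∘ Equiv.swap q r := by
    funext x
    exact congrArg T (Equiv.congr_fun (CoxeterTypeA.swap_braid hpq hpr hqr) x)
  have hm : (ortA (T p) (T q) : ℂ) * ortA (T q) (T r)
      = ortA (T p) (T r) * (ortA (T p) (T q) + ortA (T q) (T r)) := by
    exact_mod_cast congrArg ((↑) : ℝ → ℂ) (ortA_mul_ortA h1 h2 h3)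
  simp only [op, Function.comp_apply, h, Equiv.swap_apply_left, Equiv.swap_apply_right,
    Equiv.swap_apply_of_ne_of_ne hpq hpr, Equiv.swap_apply_of_ne_of_ne hpr.symm hqr.symm,
    comp_swap_comp_swap, ortA_comm (T p) (T q), ortB_comm (T p) (T q), ortA_comm (T q) (T r),
    ortB_comm (T q) (T r)]
  push_cast
  have hb1 := ortB_sq_complex (T p) (T q)
  have hb2 := ortB_sq_complex (T q) (T r)
  generalize (ortA (T p) (T q) : ℂ) = α at *
  generalize (ortA (T q) (T r) : ℂ) = β at *
  generalize (ortA (T p) (T r) : ℂ) = γ at *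
  generalize (ortB (T p) (T q) : ℂ) = a at *
  generalize (ortB (T q) (T r) : ℂ) = b at *
  generalize (ortB (T p) (T r) : ℂ) = c at *
  linear_combination (γ * G T) * hb1 - (γ * G T) * hb2 + ((α - β) * G T
    + a * G (T ∘ Equiv.swap p q) - b * G (T ∘ Equiv.swap q r)) * hm

/-- Multiplication by the content of the cell of an entry. -/
noncomputable def contentOp (p : Fin n) (G : (Fin n → ℕ × ℕ) → ℂ) (T : Fin n → ℕ × ℕ) : ℂ :=
  (content (T p) : ℂ) * G T

theorem op_contentOp_op (p q : Fin n) (G : (Fin n → ℕ × ℕ) → ℂ) {T : Fin n → ℕ × ℕ}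
    (h : content (T p) ≠ content (T q)) :
    op p q (contentOp p (op p q G)) T + op p q G T = contentOp q G T := by
  have hm : (ortA (T p) (T q) : ℂ) * ((content (T q) : ℂ) - content (T p)) = 1 := by
    exact_mod_cast congrArg ((↑) : ℝ → ℂ) (ortA_mul_sub h)
  simp only [op, contentOp, Function.comp_apply, Equiv.swap_apply_left, Equiv.swap_apply_right,
    comp_swap_comp_swap, ortA_comm (T p) (T q), ortB_comm (T p) (T q)]
  push_cast
  have hb := ortB_sq_complex (T p) (T q)
  generalize (ortA (T p) (T q) : ℂ) = α at *
  generalize (ortB (T p) (T q) : ℂ) = b at *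
  linear_combination (content (T q) * G T) * hb
    - (α * G T + b * G (T ∘ Equiv.swap p q)) * hm

end op

section standard

variable {μ : YoungDiagram} {m : ℕ} {T : Fin (m + 1) → ℕ × ℕ}

theorem le_of_swap_not_mem_syt (hT : T ∈ μ.syt (m + 1)) (i : Fin m)
    (h : T ∘ Equiv.swap i.castSucc i.succ ∉ μ.syt (m + 1)) : T i.castSucc ≤ T i.succ := by
  rw [mem_syt] at h hT
  push Not at h
  obtain ⟨j, k, hjk, hlt⟩ := h fun j => hT.1 _
  have h1 := hT.2 _ _ hjk
  have h2 : j = i.succ ∧ k = i.castSucc := by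
    rw [Equiv.swap_apply_def, Equiv.swap_apply_def] at h1
    simp only [Fin.ext_iff, Fin.le_def, Fin.lt_def, Fin.val_succ, Fin.val_castSucc] at h1 hlt ⊢
    split_ifs at h1 <;> (try simp only [Fin.val_succ, Fin.val_castSucc] at h1) <;> omega
  obtain ⟨rfl, rfl⟩ := h2
  simpa using hjk

theorem content_sub_of_le (hμ : μ.card = m + 1) (hT : T ∈ μ.syt (m + 1)) (i : Fin m)
    (h : T i.castSucc ≤ T i.succ) : |content (T i.succ) - content (T i.castSucc)| = 1 := by
  have hne : T i.castSucc ≠ T i.succ := fun h => by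
    simpa [Fin.ext_iff] using injective_of_mem_syt hT h
  have hbetween : ∀ x, T i.castSucc ≤ x → x ≤ T i.succ → x ≠ T i.castSucc → x = T i.succ := by
    intro x h1 h2 h3
    obtain ⟨l, rfl⟩ := exists_of_mem_syt hμ hT (μ.isLowerSet h2 ((mem_syt.1 hT).1 _))
    have h4 := (mem_syt.1 hT).2 _ _ h1
    have h5 := (mem_syt.1 hT).2 _ _ h2
    have h6 : l ≠ i.castSucc := fun h => h3 (by rw [h])
    congr 1
    rw [Fin.le_def] at h4 h5
    rw [Fin.ne_iff_vne] at h6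
    rw [Fin.ext_iff]
    simp only [Fin.val_succ, Fin.val_castSucc] at *
    omega
  generalize T i.castSucc = c at *
  generalize T i.succ = d at *
  obtain ⟨a, b⟩ := c
  obtain ⟨a', b'⟩ := d
  obtain ⟨h1, h2⟩ := h
  simp only at h1 h2
  rcases h1.lt_or_eq with h3 | rfl
  · have := hbetween (a + 1, b) ⟨by simp, by simp⟩ ⟨h3, h2⟩ (by simp)
    rw [← this]
    simp [content]
  · have h4 : b ≠ b' := fun h => hne (by rw [h])
    have := hbetween (a, b + 1) ⟨by simp, by simp⟩ ⟨le_rfl, by simp only; omega⟩ (by simp)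
    rw [← this]
    simp [content]

theorem ortB_eq_zero_of_not_mem (hμ : μ.card = m + 1) (hT : T ∈ μ.syt (m + 1)) (i : Fin m)
    (h : T ∘ Equiv.swap i.castSucc i.succ ∉ μ.syt (m + 1)) :
    ortB (T i.castSucc) (T i.succ) = 0 :=
  ortB_eq_zero (content_sub_of_le hμ hT i (le_of_swap_not_mem_syt hT i h))

theorem ortB_ne_zero_of_mem (hT : T ∈ μ.syt (m + 1)) (i : Fin m)
    (h : T ∘ Equiv.swap i.castSucc i.succ ∈ μ.syt (m + 1)) :
    ortB (T i.castSucc) (T i.succ) ≠ 0 := by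
  apply ortB_ne_zero
  intro hc
  have h1 : ¬ T i.castSucc ≤ T i.succ := fun hle => by
    have := (mem_syt.1 h).2 i.succ i.castSucc (by simpa using hle)
    simp [Fin.le_def] at this
  have h2 : ¬ T i.succ ≤ T i.castSucc := fun hle => by
    have := (mem_syt.1 hT).2 _ _ hle
    simp [Fin.le_def] at this
  simp only [Prod.le_def, content] at h1 h2 hc
  rw [abs_eq (by norm_num)] at hc
  omega

theorem content_ne (hμ : μ.card = m + 1) (hT : T ∈ μ.syt (m + 1)) {i j : Fin (m + 1)} (hij : i < j)
    (hj : (j : ℕ) < i + 3) : content (T i) ≠ content (T j) := by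
  intro hc
  have hnle : ¬ T j ≤ T i := fun h => not_le.2 hij ((mem_syt.1 hT).2 _ _ h)
  rw [Prod.le_def] at hnle
  unfold content at hc
  have h1 : (T i).1 < (T j).1 := by omega
  have h2 : (T i).2 < (T j).2 := by omega
  have key : ∀ x, x ≤ T j → T i ≤ x → x ≠ T i → x ≠ T j → ∃ k, T k = x ∧ i < k ∧ k < j := by
    intro x h1 h2 h3 h4
    obtain ⟨k, rfl⟩ := exists_of_mem_syt hμ hT (μ.isLowerSet h1 ((mem_syt.1 hT).1 _))
    refine ⟨k, rfl, lt_of_le_of_ne ((mem_syt.1 hT).2 _ _ h2) ?_,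
      lt_of_le_of_ne ((mem_syt.1 hT).2 _ _ h1) ?_⟩
    · rintro rfl; exact h3 rfl
    · rintro rfl; exact h4 rfl
  obtain ⟨k, hk, h3, h4⟩ := key ((T i).1 + 1, (T i).2) ⟨h1, h2.le⟩ ⟨Nat.le_succ _, le_rfl⟩
    (fun h => by simp [Prod.ext_iff] at h)
    (fun h => by have := (Prod.ext_iff.1 h).2; simp only at this; omega)
  obtain ⟨l, hl, h5, h6⟩ := key ((T i).1, (T i).2 + 1) ⟨h1.le, h2⟩ ⟨le_rfl, Nat.le_succ _⟩
    (fun h => by simp [Prod.ext_iff] at h)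
    (fun h => by have := (Prod.ext_iff.1 h).1; simp only at this; omega)
  have h7 : k ≠ l := by
    rintro rfl
    rw [hk] at hl
    simp at hl
  rw [Fin.lt_def] at h3 h4 h5 h6
  rw [Fin.ne_iff_vne] at h7
  omega

theorem eq_of_content_eq {n : ℕ} {ν : YoungDiagram} (hμ : μ.card = n) (hν : ν.card = n)
    {T S : Fin n → ℕ × ℕ} (hT : T ∈ μ.syt n) (hS : S ∈ ν.syt n)
    (h : ∀ k, content (T k) = content (S k)) : T = S := by
  have key : ∀ {μ ν : YoungDiagram} {T S : Fin n → ℕ × ℕ} (_ : T ∈ μ.syt n) (_ : S ∈ ν.syt n)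
      (_ : ν.card = n) (k : Fin n), (∀ l < k, T l = S l) → T k ≤ S k → T k = S k := by
    intro μ ν T S hT hS hν k ih hle
    obtain ⟨l, hl⟩ := exists_of_mem_syt hν hS (ν.isLowerSet hle ((mem_syt.1 hS).1 k))
    rw [← hl] at hle
    rcases ((mem_syt.1 hS).2 _ _ hle).lt_or_eq with hlt | rfl
    · rw [← ih l hlt] at hl
      exact absurd (injective_of_mem_syt hT hl) hlt.ne
    · exact hl.symm
  suffices ∀ k, T k = S k from funext this
  intro k
  induction k using WellFoundedLT.induction with
  | ind k ih =>
    have hc := h k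
    unfold content at hc
    rcases le_total (T k).1 (S k).1 with h1 | h1
    · exact key hT hS hν k ih ⟨h1, by omega⟩
    · exact (key hS hT hμ k (fun l hl => (ih l hl).symm) ⟨h1, by omega⟩).symm

theorem content_apply_zero (hμ : μ.card = m + 1) (hT : T ∈ μ.syt (m + 1)) :
    content (T 0) = 0 := by
  obtain ⟨l, hl⟩ := exists_of_mem_syt hμ hT
    (μ.isLowerSet (show (0, 0) ≤ T 0 from ⟨Nat.zero_le _, Nat.zero_le _⟩) ((mem_syt.1 hT).1 0))
  have h1 : T l ≤ T 0 := by
    rw [hl]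
    exact ⟨Nat.zero_le _, Nat.zero_le _⟩
  have h2 : l = 0 := nonpos_iff_eq_zero.1 ((mem_syt.1 hT).2 _ _ h1)
  rw [← h2, hl, content_zero]

/-- Any two standard tableaux are connected by adjacent swaps. -/
theorem eq_of_swap_invariant {α : Type*} (hμ : μ.card = m + 1) (θ : (Fin (m + 1) → ℕ × ℕ) → α)
    (hθ : ∀ T ∈ μ.syt (m + 1), ∀ i : Fin m, T ∘ Equiv.swap i.castSucc i.succ ∈ μ.syt (m + 1) →
      θ (T ∘ Equiv.swap i.castSucc i.succ) = θ T)
    {T S : Fin (m + 1) → ℕ × ℕ} (hT : T ∈ μ.syt (m + 1)) (hS : S ∈ μ.syt (m + 1)) :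
    θ T = θ S := by
  classical
  by_contra hne
  let g : ℕ × ℕ → Fin (m + 1) := Function.invFun S
  have hgS : ∀ i, g (S i) = i := Function.leftInverse_invFun (injective_of_mem_syt hS)
  let meas : (Fin (m + 1) → ℕ × ℕ) → ℤ := fun U => ∑ i : Fin (m + 1), (i : ℤ) * (g (U i) : ℤ)
  obtain ⟨U, hU, hmax⟩ := Finset.exists_max_image
    ((μ.syt (m + 1)).filter fun U => θ U ≠ θ S) meas ⟨T, Finset.mem_filter.2 ⟨hT, hne⟩⟩
  obtain ⟨hU, hUne⟩ := Finset.mem_filter.1 hU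
  have hSg : ∀ i, S (g (U i)) = U i := fun i => by
    obtain ⟨j, hj⟩ := exists_of_mem_syt hμ hS ((mem_syt.1 hU).1 i)
    rw [← hj, hgS]
  have hex : ∃ i : Fin m, g (U i.succ) < g (U i.castSucc) := by
    by_contra hno
    push Not at hno
    have hmono : Monotone fun i => g (U i) := Fin.monotone_iff_le_succ.2 hno
    have hinj : Function.Injective fun i => g (U i) := fun i j hij => by
      apply injective_of_mem_syt hU
      rw [← hSg i, ← hSg j]
      exact congrArg S hij
    have hid : (fun i => g (U i)) = id := by
      apply (hmono.strictMono_of_injective hinj).range_inj strictMono_id |>.1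
      rw [(Finite.injective_iff_surjective.1 hinj).range_eq, Set.range_id]
    apply hUne
    congr 1
    funext i
    rw [← hSg i]
    exact congrArg S (congrFun hid i)
  obtain ⟨i, hi⟩ := hex
  have hmem : U ∘ Equiv.swap i.castSucc i.succ ∈ μ.syt (m + 1) := by
    by_contra hnot
    have h1 := le_of_swap_not_mem_syt hU i hnot
    rw [← hSg, ← hSg i.succ] at h1
    exact not_le.2 hi ((mem_syt.1 hS).2 _ _ h1)
  have h2 := hmax _ (Finset.mem_filter.2 ⟨hmem, by rwa [hθ U hU i hmem]⟩)
  have h3 : meas (U ∘ Equiv.swap i.castSucc i.succ)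
      = ∑ j, ((Equiv.swap i.castSucc i.succ j : Fin (m + 1)) : ℤ) * (g (U j) : ℤ) := by
    simp only [meas]
    rw [← Equiv.sum_comp (Equiv.swap i.castSucc i.succ)]
    simp
  have h4 : meas (U ∘ Equiv.swap i.castSucc i.succ) - meas U
      = (g (U i.castSucc) : ℤ) - g (U i.succ) := by
    rw [h3, ← Finset.sum_sub_distrib]
    have hne' : i.castSucc ≠ i.succ := by simp [Fin.ext_iff]
    rw [← Finset.sum_subset (Finset.subset_univ {i.castSucc, i.succ}), Finset.sum_pair hne']
    · simp
      ring
    · intro j _ hj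
      simp only [Finset.mem_insert, Finset.mem_singleton, not_or] at hj
      rw [Equiv.swap_apply_of_ne_of_ne hj.1 hj.2, sub_self]
  rw [Fin.lt_def] at hi
  omega

end standard

/-- Extension by zero of a function on the standard fillings. -/
noncomputable def extend {μ : YoungDiagram} {n : ℕ} (F : μ.syt n → ℂ) (T : Fin n → ℕ × ℕ) : ℂ :=
  if h : T ∈ μ.syt n then F ⟨T, h⟩ else 0

theorem extend_coe {μ : YoungDiagram} {n : ℕ} (F : μ.syt n → ℂ) (T : μ.syt n) :
    extend F T = F T := by
  simp [extend]

theorem extend_of_not_mem {μ : YoungDiagram} {n : ℕ} (F : μ.syt n → ℂ) {T : Fin n → ℕ × ℕ}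
    (h : T ∉ μ.syt n) : extend F T = 0 := by
  simp [extend, h]

/-- Young's orthogonal operator on the functions on standard fillings. -/
noncomputable def youngOp (μ : YoungDiagram) {n : ℕ} (p q : Fin n) :
    (μ.syt n → ℂ) →ₗ[ℂ] (μ.syt n → ℂ) where
  toFun F T := op p q (extend F) T
  map_add' F G := by
    funext T
    simp only [op, extend, Pi.add_apply]
    split_ifs <;> ring
  map_smul' c F := by
    funext T
    simp only [op, extend, Pi.smul_apply, smul_eq_mul, RingHom.id_apply]
    split_ifs <;> ring

theorem youngOp_apply (μ : YoungDiagram) {n : ℕ} (p q : Fin n) (F : μ.syt n → ℂ) (T : μ.syt n) :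
    youngOp μ p q F T = op p q (extend F) T := rfl

section

variable {μ : YoungDiagram} {m : ℕ}

theorem extend_youngOp (hμ : μ.card = m + 1) (i : Fin m) (F : μ.syt (m + 1) → ℂ) :
    extend (youngOp μ i.castSucc i.succ F) = op i.castSucc i.succ (extend F) := by
  funext T
  by_cases hT : T ∈ μ.syt (m + 1)
  · exact (extend_coe _ ⟨T, hT⟩).trans (youngOp_apply μ _ _ F ⟨T, hT⟩)
  · rw [extend_of_not_mem _ hT, op, extend_of_not_mem _ hT]
    by_cases hS : T ∘ Equiv.swap i.castSucc i.succ ∈ μ.syt (m + 1)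
    · have h := ortB_eq_zero_of_not_mem hμ hS i (by rwa [comp_swap_comp_swap])
      simp only [Function.comp_apply, Equiv.swap_apply_left, Equiv.swap_apply_right] at h
      rw [ortB_comm, h]
      simp
    · rw [extend_of_not_mem _ hS]
      simp

theorem youngOp_mul_self (hμ : μ.card = m + 1) (i : Fin m) :
    youngOp μ i.castSucc i.succ * youngOp μ i.castSucc i.succ = 1 := by
  refine LinearMap.ext fun F => funext fun T => ?_
  rw [Module.End.mul_apply, youngOp_apply, extend_youngOp hμ, op_op, extend_coe]
  rfl

theorem youngOp_mul_comm (hμ : μ.card = m + 1) {i j : Fin m} (hij : (i : ℕ) + 1 < j) :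
    youngOp μ i.castSucc i.succ * youngOp μ j.castSucc j.succ
      = youngOp μ j.castSucc j.succ * youngOp μ i.castSucc i.succ := by
  refine LinearMap.ext fun F => funext fun T => ?_
  rw [Module.End.mul_apply, Module.End.mul_apply, youngOp_apply, youngOp_apply,
    extend_youngOp hμ, extend_youngOp hμ, op_comm] <;>
    (simp only [ne_eq, Fin.ext_iff, Fin.val_succ, Fin.val_castSucc]; omega)

theorem youngOp_braid (hμ : μ.card = m + 1) {i j : Fin m} (hij : (i : ℕ) + 1 = j) :
    youngOp μ i.castSucc i.succ * youngOp μ j.castSucc j.succ * youngOp μ i.castSucc i.succ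
      = youngOp μ j.castSucc j.succ * youngOp μ i.castSucc i.succ
        * youngOp μ j.castSucc j.succ := by
  have h : j.castSucc = i.succ := by
    simp only [Fin.ext_iff, Fin.val_succ, Fin.val_castSucc]; omega
  refine LinearMap.ext fun F => funext fun T => ?_
  simp only [Module.End.mul_apply, youngOp_apply, extend_youngOp hμ]
  rw [h, op_braid]
  · simp [Fin.ext_iff]
  · simp [Fin.ext_iff]; omega
  · simp [Fin.ext_iff]; omega
  · exact content_ne hμ T.2 Fin.castSucc_lt_succ (by simp)
  · exact content_ne hμ T.2 (by rw [Fin.lt_def]; simp; omega) (by simp; omega)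
  · exact content_ne hμ T.2 (by rw [Fin.lt_def]; simp; omega) (by simp; omega)

theorem exists_youngRep (hμ : μ.card = m + 1) :
    ∃ ρ : Representation ℂ (Equiv.Perm (Fin (m + 1))) (μ.syt (m + 1) → ℂ),
      ∀ i : Fin m, ρ (Equiv.swap i.castSucc i.succ) = youngOp μ i.castSucc i.succ := by
  let u : Fin m → (Module.End ℂ (μ.syt (m + 1) → ℂ))ˣ := fun i =>
    ⟨_, _, youngOp_mul_self hμ i, youngOp_mul_self hμ i⟩
  let t : ℕ → (Module.End ℂ (μ.syt (m + 1) → ℂ))ˣ := fun i => if h : i < m then u ⟨i, h⟩ else 1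
  have ht : ∀ i : Fin m, t i = u i := fun i => dif_pos i.2
  have hrel : CoxeterTypeA.Rels t m := by
    refine ⟨fun i hi => ?_, fun i hi => ?_, fun i j hij hj => ?_⟩
    · rw [ht ⟨i, hi⟩]
      exact Units.ext (youngOp_mul_self hμ _)
    · rw [ht ⟨i, by omega⟩, ht ⟨i + 1, hi⟩]
      exact Units.ext (youngOp_braid hμ rfl)
    · rw [ht ⟨i, by omega⟩, ht ⟨j, hj⟩]
      exact Units.ext (youngOp_mul_comm hμ hij)
  obtain ⟨φ, hφ⟩ := hrel.exists_hom
  refine ⟨(Units.coeHom _).comp φ, fun i => ?_⟩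
  rw [← CoxeterTypeA.adjSwap_coe, MonoidHom.comp_apply, hφ i i.2, ht]
  rfl

/-- The Specht module of `μ`, in Young's orthogonal form. -/
noncomputable def youngRep (hμ : μ.card = m + 1) :
    Representation ℂ (Equiv.Perm (Fin (m + 1))) (μ.syt (m + 1) → ℂ) :=
  (exists_youngRep hμ).choose

theorem youngRep_swap (hμ : μ.card = m + 1) (i : Fin m) :
    youngRep hμ (Equiv.swap i.castSucc i.succ) = youngOp μ i.castSucc i.succ :=
  (exists_youngRep hμ).choose_spec i

/-- The diagonal operator of contents of the `p`-th entry (a Jucys-Murphy element). -/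
noncomputable def jucysMurphy (μ : YoungDiagram) {n : ℕ} (p : Fin n) :
    (μ.syt n → ℂ) →ₗ[ℂ] (μ.syt n → ℂ) where
  toFun F T := (content (T.1 p) : ℂ) * F T
  map_add' F G := by
    funext T
    simp only [Pi.add_apply]; ring
  map_smul' c F := by
    funext T
    simp only [Pi.smul_apply, smul_eq_mul, RingHom.id_apply]; ring

theorem extend_jucysMurphy {n : ℕ} (p : Fin n) (F : μ.syt n → ℂ) :
    extend (jucysMurphy μ p F) = contentOp p (extend F) := by
  funext T
  by_cases hT : T ∈ μ.syt n
  · rw [contentOp, extend_coe F ⟨T, hT⟩]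
    exact extend_coe _ ⟨T, hT⟩
  · rw [contentOp, extend_of_not_mem _ hT, extend_of_not_mem _ hT, mul_zero]

theorem jucysMurphy_zero (hμ : μ.card = m + 1) : jucysMurphy μ (0 : Fin (m + 1)) = 0 := by
  refine LinearMap.ext fun F => funext fun T => ?_
  change (content (T.1 0) : ℂ) * F T = 0
  rw [content_apply_zero hμ T.2, Int.cast_zero, zero_mul]

theorem jucysMurphy_succ (hμ : μ.card = m + 1) (i : Fin m) :
    jucysMurphy μ i.succ = youngOp μ i.castSucc i.succ * jucysMurphy μ i.castSucc
      * youngOp μ i.castSucc i.succ + youngOp μ i.castSucc i.succ := by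
  refine LinearMap.ext fun F => funext fun T => ?_
  rw [LinearMap.add_apply, Pi.add_apply, Module.End.mul_apply, Module.End.mul_apply, youngOp_apply,
    youngOp_apply, extend_jucysMurphy, extend_youngOp hμ, op_contentOp_op, contentOp, extend_coe]
  · rfl
  · exact content_ne hμ T.2 Fin.castSucc_lt_succ (by simp)

variable {ν : YoungDiagram}

/-- An intertwiner commutes with the Jucys-Murphy operators. -/
theorem comp_jucysMurphy (hμ : μ.card = m + 1) (hν : ν.card = m + 1)
    {Θ : (μ.syt (m + 1) → ℂ) →ₗ[ℂ] (ν.syt (m + 1) → ℂ)}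
    (hΘ : ∀ (i : Fin m) F, Θ (youngOp μ i.castSucc i.succ F) = youngOp ν i.castSucc i.succ (Θ F))
    (p : Fin (m + 1)) : ∀ F, Θ (jucysMurphy μ p F) = jucysMurphy ν p (Θ F) := by
  induction p using Fin.induction with
  | zero =>
    intro F
    rw [jucysMurphy_zero hμ, jucysMurphy_zero hν, LinearMap.zero_apply, LinearMap.zero_apply,
      map_zero]
  | succ i ih =>
    intro F
    rw [jucysMurphy_succ hμ, jucysMurphy_succ hν]
    simp only [LinearMap.add_apply, Module.End.mul_apply, map_add, hΘ, ih]

theorem intertwiner_single (hμ : μ.card = m + 1) (hν : ν.card = m + 1)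
    {Θ : (μ.syt (m + 1) → ℂ) →ₗ[ℂ] (ν.syt (m + 1) → ℂ)}
    (hΘ : ∀ (i : Fin m) F, Θ (youngOp μ i.castSucc i.succ F) = youngOp ν i.castSucc i.succ (Θ F))
    (T : μ.syt (m + 1)) (S : ν.syt (m + 1)) (h : T.1 ≠ S.1) : Θ (Pi.single T 1) S = 0 := by
  by_contra hne
  apply h
  apply eq_of_content_eq hμ hν T.2 S.2
  intro k
  have h1 : jucysMurphy μ k (Pi.single T 1) = (content (T.1 k) : ℂ) • Pi.single T 1 := by
    funext U
    change (content (U.1 k) : ℂ) * (Pi.single T 1 : μ.syt (m + 1) → ℂ) U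
      = (content (T.1 k) : ℂ) * (Pi.single T 1 : μ.syt (m + 1) → ℂ) U
    rcases eq_or_ne U T with rfl | hU
    · rfl
    · rw [Pi.single_eq_of_ne hU, mul_zero, mul_zero]
  have h2 := congrFun (comp_jucysMurphy hμ hν hΘ k (Pi.single T 1)) S
  rw [h1, map_smul] at h2
  change (content (T.1 k) : ℂ) * Θ (Pi.single T 1) S
    = (content (S.1 k) : ℂ) * Θ (Pi.single T 1) S at h2
  exact_mod_cast mul_right_cancel₀ hne h2

theorem intertwiner_eq_zero (hμ : μ.card = m + 1) (hν : ν.card = m + 1) (hne : μ ≠ ν)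
    {Θ : (μ.syt (m + 1) → ℂ) →ₗ[ℂ] (ν.syt (m + 1) → ℂ)}
    (hΘ : ∀ (i : Fin m) F, Θ (youngOp μ i.castSucc i.succ F) = youngOp ν i.castSucc i.succ (Θ F)) :
    Θ = 0 := by
  refine (Pi.basisFun ℂ _).ext fun T => ?_
  funext S
  rw [Pi.basisFun_apply]
  refine intertwiner_single hμ hν hΘ T S fun h => hne ?_
  apply YoungDiagram.ext
  rw [← image_of_mem_syt hμ T.2, ← image_of_mem_syt hν S.2, h]

theorem intertwiner_eq_smul (hμ : μ.card = m + 1)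
    {Θ : (μ.syt (m + 1) → ℂ) →ₗ[ℂ] (μ.syt (m + 1) → ℂ)}
    (hΘ : ∀ (i : Fin m) F, Θ (youngOp μ i.castSucc i.succ F) = youngOp μ i.castSucc i.succ (Θ F)) :
    ∃ c : ℂ, Θ = c • 1 := by
  rcases isEmpty_or_nonempty (μ.syt (m + 1)) with he | ⟨⟨S⟩⟩
  · exact ⟨0, LinearMap.ext fun F => Subsingleton.elim _ _⟩
  have hdiag : ∀ F T, Θ F T = Θ (Pi.single T 1) T * F T := by
    intro F T
    have h1 : Θ F = ∑ U, F U • Θ (Pi.single U 1) := by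
      conv_lhs => rw [pi_eq_sum_univ' F]
      rw [map_sum]
      refine Finset.sum_congr rfl fun U _ => ?_
      rw [map_smul]
    rw [h1, Finset.sum_apply, Finset.sum_eq_single T]
    · rw [Pi.smul_apply, smul_eq_mul, mul_comm]
    · intro U _ hU
      rw [Pi.smul_apply, intertwiner_single hμ hμ hΘ U T (fun h => hU (Subtype.ext h)), smul_zero]
    · exact fun h => absurd (Finset.mem_univ _) h
  let θ : (Fin (m + 1) → ℕ × ℕ) → ℂ := extend fun T => Θ (Pi.single T 1) T
  refine ⟨θ S, LinearMap.ext fun F => funext fun T => ?_⟩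
  rw [hdiag]
  change _ = θ S * F T
  congr 1
  refine (extend_coe (fun T => Θ (Pi.single T 1) T) T).symm.trans ?_
  refine eq_of_swap_invariant hμ θ ?_ T.2 S.2
  intro T hT i hT'
  let T₁ : μ.syt (m + 1) := ⟨T, hT⟩
  let T₂ : μ.syt (m + 1) := ⟨T ∘ Equiv.swap i.castSucc i.succ, hT'⟩
  have hne : T₂ ≠ T₁ := by
    intro h
    have h1 := congrFun (Subtype.ext_iff.1 h) i.castSucc
    have h2 := injective_of_mem_syt hT h1
    simp [Fin.ext_iff] at h2
  have h1 := congrFun (hΘ i (Pi.single T₁ 1)) T₂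
  have hval : ∀ F : μ.syt (m + 1) → ℂ, youngOp μ i.castSucc i.succ F T₂
      = (ortA (T i.succ) (T i.castSucc) : ℂ) * F T₂
        + (ortB (T i.succ) (T i.castSucc) : ℂ) * F T₁ := by
    intro F
    rw [youngOp_apply, op, extend_coe]
    simp only [T₂, Function.comp_apply, Equiv.swap_apply_left, Equiv.swap_apply_right,
      comp_swap_comp_swap]
    rw [extend_coe F T₁]
  have s1 : (Pi.single T₁ 1 : μ.syt (m + 1) → ℂ) T₂ = 0 := Pi.single_eq_of_ne hne _
  have s2 : (Pi.single T₁ 1 : μ.syt (m + 1) → ℂ) T₁ = 1 := Pi.single_eq_same _ _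
  rw [hdiag, hval, hval, hdiag (Pi.single T₁ 1) T₂, s1, s2] at h1
  have hb : (ortB (T i.succ) (T i.castSucc) : ℂ) ≠ 0 := by
    rw [ortB_comm]
    exact_mod_cast ortB_ne_zero_of_mem hT i hT'
  have h2 : θ (T ∘ Equiv.swap i.castSucc i.succ) = Θ (Pi.single T₂ 1) T₂ :=
    extend_coe (fun T => Θ (Pi.single T 1) T) T₂
  have h3 : θ T = Θ (Pi.single T₁ 1) T₁ := extend_coe (fun T => Θ (Pi.single T 1) T) T₁
  rw [h2, h3]
  apply mul_right_cancel₀ hb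
  linear_combination h1

end

theorem numSYT_pos (n : ℕ) : ∀ μ : YoungDiagram, μ.card = n → 0 < μ.numSYT := by
  induction n with
  | zero =>
    intro μ hμ
    rw [← eq_of_le_of_card_le (bot_le : ⊥ ≤ μ) (by rw [hμ]; exact Nat.zero_le _), numSYT_bot]
    exact Nat.one_pos
  | succ n ih =>
    intro μ hμ
    rw [numSYT_eq_sum hμ]
    refine Finset.sum_pos (fun κ hκ => ih κ (by have := (mem_down.1 hκ).2; omega)) ?_
    have hne : μ.cells.Nonempty := Finset.card_pos.1 (by change 0 < μ.card; omega)
    obtain ⟨c, hc, hmax⟩ := Finset.exists_maximal hne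
    exact ⟨_, rem_mem_down hc fun x hx h => le_antisymm (hmax hx h) h⟩

end YoungDiagram

namespace FDRep

theorem sum_char_mul_char_inv {G : Type} [Group G] [Fintype G] (V W : FDRep ℂ G) [Simple V]
    [Simple W] [Decidable (Nonempty (V ≅ W))] :
    ∑ g : G, V.character g * W.character g⁻¹ = if Nonempty (V ≅ W) then (Nat.card G : ℂ) else 0 := by
  have hne : (Nat.card G : ℂ) ≠ 0 := Nat.cast_ne_zero.2 Nat.card_pos.ne'
  have := invertibleOfNonzero hne
  have h := char_orthonormal V W
  rw [inv_mul_eq_iff_eq_mul₀ hne] at h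
  rw [h]
  split_ifs <;> simp

theorem finrank_ne_zero_of_simple {G : Type} [Group G] [Finite G] (V : FDRep ℂ G) [Simple V] :
    Module.finrank ℂ V ≠ 0 := by
  classical
  intro h0
  have := Fintype.ofFinite G
  have hsub : Subsingleton V := Module.finrank_zero_iff.1 h0
  have h1 : ∀ g, V.character g = 0 := fun g => by
    have : V.ρ g = 0 := LinearMap.ext fun x => Subsingleton.elim _ _
    rw [character, this, map_zero]
  have h2 := sum_char_mul_char_inv V V
  rw [if_pos ⟨Iso.refl V⟩, Finset.sum_eq_zero fun g _ => by rw [h1, zero_mul]] at h2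
  exact Nat.card_pos.ne' (Nat.cast_eq_zero.1 h2.symm)

/-- A family of pairwise non-isomorphic simple representations with real characters whose
dimensions satisfy `∑ dim² = |G|` exhausts the simple representations. -/
theorem exists_iso_of_sum_sq_eq {G ι : Type} [Group G] [Fintype G] (s : Finset ι)
    (S : ι → FDRep ℂ G) (hS : ∀ i ∈ s, Simple (S i))
    (hiso : ∀ i ∈ s, ∀ j ∈ s, Nonempty (S i ≅ S j) → i = j)
    (hchar : ∀ i ∈ s, ∀ g, (S i).character g⁻¹ = (starRingEnd ℂ) ((S i).character g))
    (hsum : ∑ i ∈ s, Module.finrank ℂ (S i) ^ 2 = Nat.card G) (V : FDRep ℂ G) [Simple V] :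
    ∃ i ∈ s, Nonempty (V ≅ S i) := by
  classical
  by_contra hno
  push Not at hno
  let N : ℂ := Nat.card G
  have hN : N ≠ 0 := Nat.cast_ne_zero.2 Nat.card_pos.ne'
  let f : ι → ℂ := fun i => Module.finrank ℂ (S i)
  let δ : G → ℂ := fun g => if g = 1 then N else 0
  let h : G → ℂ := fun g => δ g - ∑ i ∈ s, f i * (S i).character g
  have hδ : ∀ u : G → ℂ, ∑ g, u g * δ g⁻¹ = u 1 * N := by
    intro u
    rw [Finset.sum_eq_single 1]
    · simp [δ]
    · intro g _ hg
      simp [δ, hg]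
    · simp
  have hexp : ∀ u : G → ℂ, ∑ g, u g * h g⁻¹
      = u 1 * N - ∑ i ∈ s, f i * ∑ g, u g * (S i).character g⁻¹ := by
    intro u
    rw [← hδ, Finset.sum_congr rfl fun i _ => Finset.mul_sum _ _ _, Finset.sum_comm,
      ← Finset.sum_sub_distrib]
    refine Finset.sum_congr rfl fun g _ => ?_
    simp only [h]
    rw [mul_sub, Finset.mul_sum]
    congr 1
    exact Finset.sum_congr rfl fun i _ => by ring
  have hort : ∀ j ∈ s, ∑ g, h g * (S j).character g⁻¹ = 0 := by
    intro j hj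
    have := hS j hj
    have h1 : ∑ g, (S j).character g * h g⁻¹ = 0 := by
      rw [hexp, Finset.sum_eq_single j, sum_char_mul_char_inv, if_pos ⟨Iso.refl _⟩, char_one]
      · ring
      · intro i hi hij
        have := hS i hi
        rw [sum_char_mul_char_inv, if_neg fun h => hij (hiso j hj i hi h).symm, mul_zero]
      · exact fun h => absurd hj h
    rw [← h1, ← Equiv.sum_comp (Equiv.inv G)]
    exact Finset.sum_congr rfl fun g _ => by simp [mul_comm]
  have h0 : ∑ g, h g * h g⁻¹ = 0 := by
    rw [hexp, Finset.sum_eq_zero fun i hi => by rw [hort i hi, mul_zero]]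
    have : h 1 = 0 := by
      simp only [h, δ, if_true, char_one, f]
      rw [sub_eq_zero]
      have := congrArg ((↑) : ℕ → ℂ) hsum
      push_cast at this
      refine this.symm.trans ?_
      exact Finset.sum_congr rfl fun i _ => by ring
    rw [this]
    ring
  have hstar : ∀ g, h g⁻¹ = (starRingEnd ℂ) (h g) := by
    intro g
    simp only [h, map_sub, map_sum, map_mul, δ, f, inv_eq_one, map_natCast]
    congr 1
    · split_ifs <;> simp [N]
    · exact Finset.sum_congr rfl fun i hi => by rw [hchar i hi]
  have hzero : ∀ g, h g = 0 := by
    have h1 : ∑ g, Complex.normSq (h g) = 0 := by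
      have : ((∑ g, Complex.normSq (h g) : ℝ) : ℂ) = 0 := by
        rw [← h0]
        push_cast
        exact Finset.sum_congr rfl fun g _ => by rw [hstar, Complex.mul_conj]
      exact_mod_cast this
    intro g
    have := (Finset.sum_eq_zero_iff_of_nonneg fun g _ => Complex.normSq_nonneg (h g)).1 h1 g
      (Finset.mem_univ g)
    exact Complex.normSq_eq_zero.1 this
  have h2 := hexp V.character
  rw [Finset.sum_eq_zero fun g _ => by rw [hzero, mul_zero],
    Finset.sum_eq_zero fun i hi => ?_, sub_zero, char_one] at h2
  · exact finrank_ne_zero_of_simple V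
      (Nat.cast_eq_zero.1 ((mul_eq_zero.1 h2.symm).resolve_right hN))
  · have := hS i hi
    rw [sum_char_mul_char_inv, if_neg fun h => (hno i hi).false h.some, mul_zero]

end FDRep

namespace YoungDiagram

variable {μ ν : YoungDiagram} {m : ℕ}

theorem youngRep_comp {hμ : μ.card = m + 1} {hν : ν.card = m + 1}
    {Θ : (μ.syt (m + 1) → ℂ) →ₗ[ℂ] (ν.syt (m + 1) → ℂ)}
    (hΘ : ∀ g F, Θ (youngRep hμ g F) = youngRep hν g (Θ F)) (i : Fin m)
    (F : μ.syt (m + 1) → ℂ) :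
    Θ (youngOp μ i.castSucc i.succ F) = youngOp ν i.castSucc i.succ (Θ F) := by
  rw [← youngRep_swap hμ, ← youngRep_swap hν, hΘ]

theorem finrank_syt (hμ : μ.card = m + 1) : Module.finrank ℂ (μ.syt (m + 1) → ℂ) = μ.numSYT := by
  rw [Module.finrank_fintype_fun_eq_card, Fintype.card_coe, numSYT, hμ]

theorem simple_youngRep (hμ : μ.card = m + 1) : Simple (FDRep.of (youngRep hμ)) := by
  have hne : NeZero (Nat.card (Equiv.Perm (Fin (m + 1))) : ℂ) :=
    ⟨Nat.cast_ne_zero.2 Nat.card_pos.ne'⟩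
  rw [FDRep.simple_iff_end_is_rank_one,
    ← (Representation.linHom.invariantsEquivFDRepHom _ _).finrank_eq]
  have hpos : 0 < Module.finrank ℂ (μ.syt (m + 1) → ℂ) := by
    rw [finrank_syt hμ]
    exact numSYT_pos _ μ hμ
  have hnt : Nontrivial (μ.syt (m + 1) → ℂ) := Module.nontrivial_of_finrank_pos hpos
  have hmem : ∀ Θ : (μ.syt (m + 1) → ℂ) →ₗ[ℂ] (μ.syt (m + 1) → ℂ),
      Θ ∈ (Representation.linHom (youngRep hμ) (youngRep hμ)).invariants ↔
        ∀ g F, Θ (youngRep hμ g F) = youngRep hμ g (Θ F) := by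
    intro Θ
    rw [Representation.mem_invariants]
    constructor
    · intro h g F
      have h1 := LinearMap.congr_fun (h g) (youngRep hμ g F)
      rw [Representation.linHom_apply, LinearMap.comp_apply, LinearMap.comp_apply,
        Representation.inv_self_apply] at h1
      exact h1.symm
    · intro h g
      refine LinearMap.ext fun F => ?_
      rw [Representation.linHom_apply, LinearMap.comp_apply, LinearMap.comp_apply, ← h,
        Representation.self_inv_apply]
  refine (finrank_eq_one_iff_of_nonzero'
    (⟨1, (hmem 1).2 fun g F => rfl⟩ :
      (Representation.linHom (youngRep hμ) (youngRep hμ)).invariants) ?_).2 ?_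
  · intro h
    exact one_ne_zero (Subtype.ext_iff.1 h)
  · rintro ⟨Θ, hΘ⟩
    obtain ⟨c, rfl⟩ := intertwiner_eq_smul hμ (youngRep_comp ((hmem Θ).1 hΘ))
    exact ⟨c, rfl⟩

theorem eq_of_youngRep_iso (hμ : μ.card = m + 1) (hν : ν.card = m + 1)
    (h : Nonempty (FDRep.of (youngRep hμ) ≅ FDRep.of (youngRep hν))) : μ = ν := by
  obtain ⟨e⟩ := h
  by_contra hne
  let E : (μ.syt (m + 1) → ℂ) ≃ₗ[ℂ] (ν.syt (m + 1) → ℂ) := FDRep.isoToLinearEquiv e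
  have hE : ∀ g F, E.toLinearMap (youngRep hμ g F) = youngRep hν g (E.toLinearMap F) := by
    intro g F
    have h1 : youngRep hν g = E.conj (youngRep hμ g) := FDRep.Iso.conj_ρ e g
    rw [h1, LinearEquiv.conj_apply]
    simp
  have h0 : E.toLinearMap = 0 := intertwiner_eq_zero hμ hν hne (youngRep_comp hE)
  have hpos : 0 < Module.finrank ℂ (μ.syt (m + 1) → ℂ) := by
    rw [finrank_syt hμ]
    exact numSYT_pos _ μ hμ
  have hnt : Nontrivial (μ.syt (m + 1) → ℂ) := Module.nontrivial_of_finrank_pos hpos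
  obtain ⟨x, hx⟩ := exists_ne (0 : μ.syt (m + 1) → ℂ)
  exact hx (E.injective (by rw [map_zero]; exact LinearMap.congr_fun h0 x))

theorem youngOp_star (p q : Fin (m + 1)) (F : μ.syt (m + 1) → ℂ) :
    youngOp μ p q (star F) = star (youngOp μ p q F) := by
  have h : ∀ T, extend (star F) T = star (extend F T) := by
    intro T
    simp only [extend]
    split_ifs <;> simp
  funext T
  rw [Pi.star_apply, youngOp_apply, youngOp_apply, op, op, h, h]
  simp

theorem youngRep_star (hμ : μ.card = m + 1) (g : Equiv.Perm (Fin (m + 1)))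
    (F : μ.syt (m + 1) → ℂ) : youngRep hμ g (star F) = star (youngRep hμ g F) := by
  have hg : g ∈ Submonoid.closure
      (Set.range fun i : Fin m => Equiv.swap i.castSucc i.succ) := by
    rw [Equiv.Perm.mclosure_swap_castSucc_succ]; trivial
  induction hg using Submonoid.closure_induction generalizing F with
  | mem x hx =>
    obtain ⟨i, rfl⟩ := hx
    rw [youngRep_swap, youngOp_star]
  | one => rw [map_one]; rfl
  | mul x y _ _ hx hy =>
    rw [map_mul, Module.End.mul_apply, Module.End.mul_apply, hy, hx]

theorem character_youngRep_inv (hμ : μ.card = m + 1) (g : Equiv.Perm (Fin (m + 1))) :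
    (FDRep.of (youngRep hμ)).character g⁻¹
      = (starRingEnd ℂ) ((FDRep.of (youngRep hμ)).character g) := by
  have h1 : (FDRep.of (youngRep hμ)).character g⁻¹ = (FDRep.of (youngRep hμ)).character g := by
    have : IsConj g g⁻¹ := by
      rw [Equiv.Perm.isConj_iff_cycleType_eq, Equiv.Perm.cycleType_inv]
    obtain ⟨c, hc⟩ := isConj_iff.1 this
    rw [← hc, FDRep.char_conj]
  rw [h1]
  change LinearMap.trace ℂ (μ.syt (m + 1) → ℂ) (youngRep hμ g)
    = (starRingEnd ℂ) (LinearMap.trace ℂ (μ.syt (m + 1) → ℂ) (youngRep hμ g))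
  rw [LinearMap.trace_eq_matrix_trace ℂ (Pi.basisFun ℂ _), Matrix.trace, map_sum]
  refine Finset.sum_congr rfl fun T _ => ?_
  rw [Matrix.diag_apply, LinearMap.toMatrix_apply, Pi.basisFun_apply, Pi.basisFun_repr]
  have h2 : star (Pi.single T 1 : μ.syt (m + 1) → ℂ) = Pi.single T 1 := by
    rw [← Pi.single_star, star_one]
  have h3 := youngRep_star hμ g (Pi.single T 1)
  rw [h2] at h3
  exact congrFun h3 T

theorem cd_perm (m : ℕ) :
    cd (Equiv.Perm (Fin (m + 1))) = {d | ∃ μ : YoungDiagram, μ.card = m + 1 ∧ μ.numSYT = d} := by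
  have hfin : ∀ {μ : YoungDiagram} (hμ : μ.card = m + 1),
      Module.finrank ℂ (FDRep.of (youngRep hμ)) = μ.numSYT := fun hμ => finrank_syt hμ
  ext d
  constructor
  · rintro ⟨V, hV, rfl⟩
    obtain ⟨μ, -, ⟨e⟩⟩ := FDRep.exists_iso_of_sum_sq_eq (diagrams (m + 1)).attach
      (fun μ => FDRep.of (youngRep (mem_diagrams.1 μ.2))) (fun μ _ => simple_youngRep _)
      (fun μ _ ν _ h => Subtype.ext (eq_of_youngRep_iso _ _ h))
      (fun μ _ g => character_youngRep_inv _ g) (by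
        rw [Finset.sum_congr rfl fun μ _ => congrArg (· ^ 2) (hfin (mem_diagrams.1 μ.2))]
        refine (Finset.sum_attach (diagrams (m + 1)) fun μ => μ.numSYT ^ 2).trans ?_
        rw [sum_numSYT_sq, Nat.card_perm, Nat.card_fin]) V
    refine ⟨μ, mem_diagrams.1 μ.2, ?_⟩
    rw [← hfin (mem_diagrams.1 μ.2)]
    exact (FDRep.isoToLinearEquiv e).finrank_eq.symm
  · rintro ⟨μ, hμ, rfl⟩
    exact ⟨FDRep.of (youngRep hμ), simple_youngRep hμ, hfin hμ⟩

theorem card_transpose (μ : YoungDiagram) : μ.transpose.card = μ.card := by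
  refine Finset.card_bij' (fun c _ => c.swap) (fun c _ => c.swap) ?_ ?_ ?_ ?_
  · intro c hc
    rw [mem_cells, mem_transpose] at hc
    rwa [mem_cells]
  · intro c hc
    rw [mem_cells] at hc
    rw [mem_cells, mem_transpose]
    simpa using hc
  · simp
  · simp

theorem transpose_mem_down {μ κ : YoungDiagram} (h : κ ∈ μ.down) : κ.transpose ∈ μ.transpose.down := by
  rw [mem_down] at h ⊢
  exact ⟨transpose_le_iff.2 h.1, by rw [card_transpose, card_transpose, h.2]⟩

theorem numSYT_transpose (n : ℕ) : ∀ μ : YoungDiagram, μ.card = n →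
    μ.transpose.numSYT = μ.numSYT := by
  induction n with
  | zero =>
    intro μ hμ
    have : μ = ⊥ := (eq_of_le_of_card_le bot_le (by rw [hμ]; exact Nat.zero_le _)).symm
    subst this
    congr 1
  | succ n ih =>
    intro μ hμ
    rw [numSYT_eq_sum hμ, numSYT_eq_sum ((card_transpose μ).trans hμ)]
    symm
    refine Finset.sum_bij' (fun κ _ => κ.transpose) (fun κ _ => κ.transpose) ?_ ?_ ?_ ?_ ?_
    · exact fun κ hκ => transpose_mem_down hκ
    · intro κ hκ
      have := transpose_mem_down hκ
      rwa [transpose_transpose] at this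
    · exact fun κ _ => transpose_transpose κ
    · exact fun κ _ => transpose_transpose κ
    · intro κ hκ
      refine (ih κ ?_).symm
      have := (mem_down.1 hκ).2
      omega

theorem remRow_mem_down {μ : YoungDiagram} {i : ℕ} (hi : i ∈ μ.remRows) : μ.remRow i ∈ μ.down := by
  rw [down_eq_image]
  exact Finset.mem_image_of_mem _ hi

theorem card_remRow {μ : YoungDiagram} {i : ℕ} (hi : i ∈ μ.remRows) :
    (μ.remRow i).card + 1 = μ.card :=
  (mem_down.1 (remRow_mem_down hi)).2

theorem numSYT_le_of_mem_down {μ κ : YoungDiagram} (h : κ ∈ μ.down) : κ.numSYT ≤ μ.numSYT := by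
  have := (mem_down.1 h).2
  rw [numSYT_eq_sum this.symm]
  exact Finset.single_le_sum (f := numSYT) (fun _ _ => Nat.zero_le _) h

theorem numSYT_add_le {μ κ ν : YoungDiagram} (hκ : κ ∈ μ.down) (hν : ν ∈ μ.down) (hne : κ ≠ ν) :
    κ.numSYT + ν.numSYT ≤ μ.numSYT := by
  have := (mem_down.1 hκ).2
  rw [numSYT_eq_sum this.symm, ← Finset.sum_pair hne]
  refine Finset.sum_le_sum_of_subset ?_
  rw [Finset.insert_subset_iff, Finset.singleton_subset_iff]
  exact ⟨hκ, hν⟩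

theorem rowLen_mono {μ κ : YoungDiagram} (h : κ ≤ μ) (i : ℕ) : κ.rowLen i ≤ μ.rowLen i := by
  by_contra hlt
  push Not at hlt
  have := h (mem_iff_lt_rowLen.2 hlt)
  rw [mem_iff_lt_rowLen] at this
  exact lt_irrefl _ this

theorem colLen_mono {μ κ : YoungDiagram} (h : κ ≤ μ) (i : ℕ) : κ.colLen i ≤ μ.colLen i := by
  simpa using rowLen_mono (transpose_le_iff.2 h) i

theorem card_eq_sum_rowLen {μ : YoungDiagram} {N : ℕ} (h : μ.rowLen N = 0) :
    μ.card = ∑ i ∈ Finset.range N, μ.rowLen i := by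
  rw [YoungDiagram.card, Finset.card_eq_sum_card_fiberwise (f := Prod.fst) (t := Finset.range N)]
  · refine Finset.sum_congr rfl fun i _ => ?_
    rw [rowLen_eq_card, row]
  · intro c hc
    rw [Finset.mem_coe, mem_cells] at hc
    rw [Finset.mem_coe, Finset.mem_range]
    by_contra hN
    push Not at hN
    have h1 : (c.1, c.2) ∈ μ := hc
    rw [mem_iff_lt_rowLen] at h1
    have := μ.rowLen_anti _ _ hN
    omega

theorem rowLen_colLen_zero (μ : YoungDiagram) : μ.rowLen (μ.colLen 0) = 0 := by
  have := (rowLen_pos_iff (μ := μ) (i := μ.colLen 0)).not.2 (lt_irrefl _)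
  omega

theorem sum_rowLen_le_card (μ : YoungDiagram) (N : ℕ) :
    ∑ i ∈ Finset.range N, μ.rowLen i ≤ μ.card := by
  rw [card_eq_sum_rowLen (N := max N (μ.colLen 0))]
  · exact Finset.sum_le_sum_of_subset (Finset.range_mono (le_max_left _ _))
  · have := μ.rowLen_anti _ _ (le_max_right N (μ.colLen 0))
    rw [rowLen_colLen_zero] at this
    omega

theorem rowLen_zero_le_card (μ : YoungDiagram) : μ.rowLen 0 ≤ μ.card := by
  simpa using sum_rowLen_le_card μ 1

theorem colLen_zero_pos {μ : YoungDiagram} (h : 0 < μ.card) : 0 < μ.colLen 0 := by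
  by_contra h0
  have h1 : μ.colLen 0 = 0 := by omega
  have := card_eq_sum_rowLen μ.rowLen_colLen_zero
  rw [h1, Finset.sum_range_zero] at this
  omega

theorem last_mem_remRows {μ : YoungDiagram} (h : 0 < μ.card) : μ.colLen 0 - 1 ∈ μ.remRows := by
  have h1 := colLen_zero_pos h
  rw [mem_remRows, Nat.sub_add_cancel h1, rowLen_colLen_zero, rowLen_pos_iff]
  omega

theorem one_lt_colLen_zero {μ : YoungDiagram} (h : μ.rowLen 0 < μ.card) : 1 < μ.colLen 0 := by
  by_contra h0
  have h1 : μ.rowLen 1 = 0 := by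
    have := (rowLen_pos_iff (μ := μ) (i := 1)).not.2 h0
    omega
  have := card_eq_sum_rowLen h1
  simp at this
  omega

/-- Lower bound by the ballot numbers. -/
theorem choose_le_numSYT_add (n : ℕ) : ∀ (k : ℕ) (μ : YoungDiagram), μ.card = n → μ.rowLen 0 + (k + 1) = n →
      k + 1 ≤ μ.rowLen 0 → n.choose (k + 1) ≤ μ.numSYT + n.choose k := by
  induction n with
  | zero => intro k μ _ h; omega
  | succ n ih =>
    intro k μ hμ hk hle
    have hl := one_lt_colLen_zero (μ := μ) (by omega)
    set i := μ.colLen 0 - 1 with hi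
    have hir : i ∈ μ.remRows := last_mem_remRows (by omega)
    have hci := card_remRow hir
    have hri : (μ.remRow i).rowLen 0 = μ.rowLen 0 := by
      rw [rowLen_remRow hir, if_neg (by omega)]
    have h1 : n.choose k ≤ (μ.remRow i).numSYT + (if k = 0 then 0 else n.choose (k - 1)) := by
      rcases k with _ | k
      · simpa [Nat.one_le_iff_ne_zero] using (numSYT_pos _ (μ.remRow i) rfl).ne'
      · exact ih k (μ.remRow i) (by omega) (by omega) (by omega)
    have h2 : (n + 1).choose k = n.choose k + (if k = 0 then 0 else n.choose (k - 1)) := by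
      rcases k with _ | k
      · simp
      · simp [Nat.choose_succ_succ, add_comm]
    rw [Nat.choose_succ_succ', h2]
    rcases hle.lt_or_eq with hlt | heq
    · have h0r : 0 ∈ μ.remRows := by
        rw [mem_remRows]
        have := sum_rowLen_le_card μ 2
        simp only [Finset.sum_range_succ, Finset.sum_range_zero, zero_add] at this ⊢
        omega
      have hc0 := card_remRow h0r
      have hr0 : (μ.remRow 0).rowLen 0 = μ.rowLen 0 - 1 := by
        rw [rowLen_remRow h0r, if_pos rfl]
      have h3 := ih k (μ.remRow 0) (by omega) (by omega) (by omega)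
      have h4 := numSYT_add_le (remRow_mem_down hir) (remRow_mem_down h0r) (by
        intro h
        have := μ.injOn_remRow hir h0r h
        omega)
      omega
    · have h3 : n.choose (k + 1) = n.choose k := by
        have : n = k + (k + 1) := by omega
        rw [this, Nat.choose_symm_add]
      have h4 := numSYT_le_of_mem_down (remRow_mem_down hir)
      omega

theorem card_down (μ : YoungDiagram) : μ.down.card = μ.remRows.card := by
  rw [down_eq_image, Finset.card_image_of_injOn μ.injOn_remRow]

theorem one_lt_card_down {μ : YoungDiagram} {i j : ℕ} (hi : i ∈ μ.remRows) (hj : j ∈ μ.remRows)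
    (hij : i ≠ j) : 1 < μ.down.card := by
  rw [card_down]
  exact Finset.one_lt_card.2 ⟨i, hi, j, hj, hij⟩

/-- A diagram with only one removable cell is a rectangle. -/
theorem rowLen_eq_of_card_down_le_one {μ : YoungDiagram} (h : μ.down.card ≤ 1) {i : ℕ}
    (hi : i < μ.colLen 0) : μ.rowLen i = μ.rowLen 0 := by
  induction i with
  | zero => rfl
  | succ i ih =>
    have h1 := ih (by omega)
    by_contra hne
    have h2 := μ.rowLen_anti i (i + 1) (by omega)
    have h3 : i ∈ μ.remRows := mem_remRows.2 (by omega)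
    have h4 : μ.colLen 0 - 1 ∈ μ.remRows := last_mem_remRows (by
      have := rowLen_pos_iff.2 hi
      have h5 := rowLen_zero_le_card μ
      have := μ.rowLen_anti 0 (i + 1) (by omega)
      omega)
    have := one_lt_card_down h3 h4 (by omega)
    omega

theorem card_eq_mul_of_card_down_le_one {μ : YoungDiagram} (h : μ.down.card ≤ 1) :
    μ.card = μ.colLen 0 * μ.rowLen 0 := by
  rw [card_eq_sum_rowLen μ.rowLen_colLen_zero, Finset.sum_congr rfl fun i hi =>
    rowLen_eq_of_card_down_le_one h (Finset.mem_range.1 hi)]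
  simp

theorem exists_mem_down_of_card_down_le_one {μ : YoungDiagram} (h : μ.down.card ≤ 1)
    (hr : 2 ≤ μ.rowLen 0) (hc : 2 ≤ μ.colLen 0) : ∃ κ ∈ μ.down, 1 < κ.down.card := by
  have h1 := rowLen_eq_of_card_down_le_one h (i := μ.colLen 0 - 1) (by omega)
  have h2 := rowLen_eq_of_card_down_le_one h (i := μ.colLen 0 - 2) (by omega)
  have h3 : μ.colLen 0 - 1 ∈ μ.remRows := last_mem_remRows (by
    have := rowLen_zero_le_card μ
    omega)
  refine ⟨_, remRow_mem_down h3, one_lt_card_down (i := μ.colLen 0 - 1) (j := μ.colLen 0 - 2)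
    ?_ ?_ (by omega)⟩
  · rw [mem_remRows, rowLen_remRow h3, rowLen_remRow h3, if_pos rfl, if_neg (by omega),
      Nat.sub_add_cancel (by omega), rowLen_colLen_zero]
    omega
  · rw [mem_remRows, rowLen_remRow h3, rowLen_remRow h3, if_pos (by omega), if_neg (by omega)]
    omega

theorem exists_pair_mem_down {μ : YoungDiagram} (h : 1 < μ.down.card) :
    ∃ κ ∈ μ.down, ∃ ν ∈ μ.down, κ.numSYT + ν.numSYT ≤ μ.numSYT := by
  obtain ⟨κ, hκ, ν, hν, hne⟩ := Finset.one_lt_card.1 h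
  exact ⟨κ, hκ, ν, hν, numSYT_add_le hκ hν hne⟩

/-- Of two diagrams obtained by removing a cell, at most one is a rectangle. -/
theorem exists_pair_mem_down_of_four_le {μ : YoungDiagram} (h : 1 < μ.down.card)
    (h4 : 4 ≤ μ.card) :
    ∃ κ ∈ μ.down, ∃ ν ∈ μ.down, κ.numSYT + ν.numSYT ≤ μ.numSYT ∧ 1 < κ.down.card := by
  rw [card_down, Finset.one_lt_card] at h
  obtain ⟨i, j, hi, hj, hij⟩ : ∃ i j, i ∈ μ.remRows ∧ j ∈ μ.remRows ∧ i < j := by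
    obtain ⟨i, hi, j, hj, hne⟩ := h
    rcases lt_or_gt_of_ne hne with h | h
    exacts [⟨i, j, hi, hj, h⟩, ⟨j, i, hj, hi, h⟩]
  have hne : μ.remRow i ≠ μ.remRow j := fun h => hij.ne (μ.injOn_remRow hi hj h)
  have hdi := remRow_mem_down hi
  have hdj := remRow_mem_down hj
  have hi' := mem_remRows.1 hi
  have hj' := mem_remRows.1 hj
  have hanti := μ.rowLen_anti (i + 1) j hij
  by_cases hb : j = i + 1 ∧ μ.rowLen j = 1
  · obtain ⟨rfl, hb⟩ := hb
    refine ⟨_, hdi, _, hdj, numSYT_add_le hdi hdj hne, ?_⟩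
    have hj2 : i + 1 ∈ (μ.remRow i).remRows := by
      rw [mem_remRows, rowLen_remRow hi, rowLen_remRow hi, if_neg (by omega), if_neg (by omega)]
      exact hj'
    by_cases h2 : μ.rowLen i = 2
    · by_cases h0 : i = 0
      · subst h0
        have := card_eq_sum_rowLen (μ := μ) (N := 2) (by
          simp only [zero_add, Nat.reduceAdd] at *
          omega)
        simp only [Finset.sum_range_succ, Finset.sum_range_zero, zero_add] at this hb
        omega
      · refine one_lt_card_down hj2 (j := i - 1) ?_ (by omega)
        have := μ.rowLen_anti (i - 1) i (by omega)
        rw [mem_remRows, rowLen_remRow hi, rowLen_remRow hi, if_pos (by omega), if_neg (by omega)]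
        omega
    · refine one_lt_card_down hj2 (j := i) ?_ (by omega)
      rw [mem_remRows, rowLen_remRow hi, rowLen_remRow hi, if_neg (by omega), if_pos (by omega)]
      omega
  · refine ⟨_, hdj, _, hdi, numSYT_add_le hdj hdi hne.symm, ?_⟩
    have hi2 : i ∈ (μ.remRow j).remRows := by
      rw [mem_remRows, rowLen_remRow hj, rowLen_remRow hj, if_neg (c := i = j) (by omega)]
      split_ifs with h
      · rw [← h]
        omega
      · exact hi'
    have h1 : 0 < (μ.remRow j).rowLen (i + 1) := by
      rw [rowLen_remRow hj]
      split_ifs with h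
      · omega
      · have := μ.rowLen_anti (i + 1) j hij
        omega
    have h2 := rowLen_pos_iff.1 h1
    have h3 := card_remRow hj
    exact one_lt_card_down hi2 (last_mem_remRows (by omega)) (by omega)

/-- `x` is a lower bound for the number of standard tableaux on the non-rectangular diagrams with
`n` cells whose first row and first column contain at most about half of the cells. -/
def CentralBound (n x : ℕ) : Prop :=
  ∀ μ : YoungDiagram, μ.card = n → 2 * μ.rowLen 0 ≤ n + 1 → 2 * μ.colLen 0 ≤ n + 1 →
    1 < μ.down.card → x ≤ μ.numSYT

theorem choose_le_numSYT_add_col {n k : ℕ} {μ : YoungDiagram} (hn : μ.card = n)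
    (hk : μ.colLen 0 + (k + 1) = n) (hle : k + 1 ≤ μ.colLen 0) :
    n.choose (k + 1) ≤ μ.numSYT + n.choose k := by
  rw [← numSYT_transpose n μ hn]
  exact choose_le_numSYT_add n k _ ((card_transpose μ).trans hn) (by simpa using hk)
    (by simpa using hle)

theorem card_le_mul (μ : YoungDiagram) : μ.card ≤ μ.colLen 0 * μ.rowLen 0 := by
  rw [card_eq_sum_rowLen μ.rowLen_colLen_zero]
  refine (Finset.sum_le_card_nsmul _ _ (μ.rowLen 0) fun i _ => μ.rowLen_anti 0 i (by omega)).trans ?_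
  simp

/-- It suffices to bound the diagrams whose first row and column contain less than half of the
cells. -/
theorem CentralBound.of_lt {k n z : ℕ} (hkn : 2 * (k + 1) = n ∨ 2 * (k + 1) + 1 = n)
    (hz : z + n.choose k ≤ n.choose (k + 1))
    (h : ∀ μ : YoungDiagram, μ.card = n → 2 * μ.rowLen 0 < n → 2 * μ.colLen 0 < n →
      1 < μ.down.card → z ≤ μ.numSYT) : CentralBound n z := by
  intro μ hμ hr hc hd
  by_cases h1 : 2 * μ.rowLen 0 < n
  · by_cases h2 : 2 * μ.colLen 0 < n
    · exact h μ hμ h1 h2 hd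
    · have := choose_le_numSYT_add_col (k := k) hμ (by omega) (by omega)
      omega
  · have := choose_le_numSYT_add n k μ hμ (by omega) (by omega)
    omega

theorem rowLen_le_of_mem_down {μ κ : YoungDiagram} (h : κ ∈ μ.down) (i : ℕ) :
    κ.rowLen i ≤ μ.rowLen i := rowLen_mono (mem_down.1 h).1 i

theorem colLen_le_of_mem_down {μ κ : YoungDiagram} (h : κ ∈ μ.down) (i : ℕ) :
    κ.colLen i ≤ μ.colLen i := colLen_mono (mem_down.1 h).1 i

theorem two_le_lens {μ : YoungDiagram} {n : ℕ} (hn : 2 ≤ n) (hμ : μ.card = n)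
    (hr : 2 * μ.rowLen 0 ≤ n + 1) (hc : 2 * μ.colLen 0 ≤ n + 1) :
    2 ≤ μ.rowLen 0 ∧ 2 ≤ μ.colLen 0 := by
  have := card_le_mul μ
  constructor
  · by_contra h
    have : μ.rowLen 0 = 0 ∨ μ.rowLen 0 = 1 := by omega
    rcases this with h | h <;> rw [h] at this <;> omega
  · by_contra h
    have : μ.colLen 0 = 0 ∨ μ.colLen 0 = 1 := by omega
    rcases this with h | h <;> rw [h] at this <;> omega

theorem CentralBound.step {n x y z k : ℕ} (hx : CentralBound n x) (hy : CentralBound (n + 1) y)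
    (hn : 2 ≤ n) (hxy : x ≤ y) (hkn : 2 * (k + 1) = n + 2 ∨ 2 * (k + 1) + 1 = n + 2)
    (hzb : z + (n + 2).choose k ≤ (n + 2).choose (k + 1)) (hz : z ≤ x + y) :
    CentralBound (n + 2) z := by
  refine CentralBound.of_lt hkn hzb fun μ hμ hr hc hd => ?_
  obtain ⟨κ, hκ, ν, hν, hle, hκd⟩ := exists_pair_mem_down_of_four_le hd (by omega)
  have hκc := (mem_down.1 hκ).2
  have hνc := (mem_down.1 hν).2
  have h1 := hy κ (by omega) (by have := rowLen_le_of_mem_down hκ 0; omega)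
    (by have := colLen_le_of_mem_down hκ 0; omega) hκd
  have hνr := rowLen_le_of_mem_down hν 0
  have hνl := colLen_le_of_mem_down hν 0
  have h2 : x ≤ ν.numSYT := by
    by_cases hνd : 1 < ν.down.card
    · exact hxy.trans (hy ν (by omega) (by omega) (by omega) hνd)
    · have h3 := two_le_lens (n := n + 1) (μ := ν) (by omega) (by omega) (by omega) (by omega)
      obtain ⟨ρ, hρ, hρd⟩ := exists_mem_down_of_card_down_le_one (by omega) h3.1 h3.2
      have hρc := (mem_down.1 hρ).2
      refine (hx ρ (by omega) ?_ ?_ hρd).trans (numSYT_le_of_mem_down hρ)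
      · have := rowLen_le_of_mem_down hρ 0; omega
      · have := colLen_le_of_mem_down hρ 0; omega
  omega

theorem CentralBound.step_of_prime {n y z k : ℕ} (hy : CentralBound n y) (hp : n.Prime)
    (hn : 2 ≤ n) (hkn : 2 * (k + 1) = n + 1 ∨ 2 * (k + 1) + 1 = n + 1)
    (hzb : z + (n + 1).choose k ≤ (n + 1).choose (k + 1)) (hz : z ≤ 2 * y) :
    CentralBound (n + 1) z := by
  refine CentralBound.of_lt hkn hzb fun μ hμ hr hc hd => ?_
  obtain ⟨κ, hκ, ν, hν, hle⟩ := exists_pair_mem_down hd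
  have h : ∀ ρ ∈ μ.down, y ≤ ρ.numSYT := by
    intro ρ hρ
    have hρc := (mem_down.1 hρ).2
    have h1 := rowLen_le_of_mem_down hρ 0
    have h2 := colLen_le_of_mem_down hρ 0
    refine hy ρ (by omega) (by omega) (by omega) ?_
    by_contra hd
    have h3 := two_le_lens (n := n) (μ := ρ) hn (by omega) (by omega) (by omega)
    have h4 := card_eq_mul_of_card_down_le_one (μ := ρ) (by omega)
    refine Nat.not_prime_mul (a := ρ.colLen 0) (b := ρ.rowLen 0) (by omega) (by omega) ?_
    rw [← h4]
    convert hp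
    omega
  have := h κ hκ
  have := h ν hν
  omega

theorem centralBound_five : CentralBound 5 5 := by
  refine CentralBound.of_lt (k := 1) (by omega) (by decide) fun μ hμ hr hc _ => ?_
  have h1 := card_le_mul μ
  have : μ.colLen 0 * μ.rowLen 0 ≤ 2 * 2 := Nat.mul_le_mul (by omega) (by omega)
  omega

theorem centralBound_six : CentralBound 6 5 := by
  refine CentralBound.of_lt (k := 2) (by omega) (by decide) fun μ hμ hr hc _ => ?_
  have h1 := card_le_mul μ
  have : μ.colLen 0 * μ.rowLen 0 ≤ 2 * 2 := Nat.mul_le_mul (by omega) (by omega)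
  omega

theorem centralBound_twentytwo_twentythree :
    CentralBound 22 21450 ∧ CentralBound 23 34320 := by
  have h7 : CentralBound 7 10 :=
    centralBound_five.step (k := 2) centralBound_six (by omega) (by omega) (by omega)
      (by decide) (by omega)
  have h8 : CentralBound 8 14 :=
    h7.step_of_prime (k := 3) (by norm_num) (by omega) (by omega) (by decide) (by omega)
  have h9 : CentralBound 9 24 :=
    h7.step (k := 3) h8 (by omega) (by omega) (by omega) (by decide) (by omega)
  have h10 : CentralBound 10 38 :=
    h8.step (k := 4) h9 (by omega) (by omega) (by omega) (by decide) (by omega)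
  have h11 : CentralBound 11 62 :=
    h9.step (k := 4) h10 (by omega) (by omega) (by omega) (by decide) (by omega)
  have h12 : CentralBound 12 124 :=
    h11.step_of_prime (k := 5) (by norm_num) (by omega) (by omega) (by decide) (by omega)
  have h13 : CentralBound 13 186 :=
    h11.step (k := 5) h12 (by omega) (by omega) (by omega) (by decide) (by omega)
  have h14 : CentralBound 14 372 :=
    h13.step_of_prime (k := 6) (by norm_num) (by omega) (by omega) (by decide) (by omega)
  have h15 : CentralBound 15 558 :=
    h13.step (k := 6) h14 (by omega) (by omega) (by omega) (by decide) (by omega)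
  have h16 : CentralBound 16 930 :=
    h14.step (k := 7) h15 (by omega) (by omega) (by omega) (by decide) (by omega)
  have h17 : CentralBound 17 1430 :=
    h15.step (k := 7) h16 (by omega) (by omega) (by omega) (by decide) (by omega)
  have h18 : CentralBound 18 2860 :=
    h17.step_of_prime (k := 8) (by norm_num) (by omega) (by omega) (by decide) (by omega)
  have h19 : CentralBound 19 4290 :=
    h17.step (k := 8) h18 (by omega) (by omega) (by omega) (by decide) (by omega)
  have h20 : CentralBound 20 8580 :=
    h19.step_of_prime (k := 9) (by norm_num) (by omega) (by omega) (by decide) (by omega)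
  have h21 : CentralBound 21 12870 :=
    h19.step (k := 9) h20 (by omega) (by omega) (by omega) (by decide) (by omega)
  have h22 : CentralBound 22 21450 :=
    h20.step (k := 10) h21 (by omega) (by omega) (by omega) (by decide) (by omega)
  have h23 : CentralBound 23 34320 :=
    h21.step (k := 10) h22 (by omega) (by omega) (by omega) (by decide) (by omega)
  exact ⟨h22, h23⟩

theorem three_mul_choose_four_le {n : ℕ} (hn : 19 ≤ n) : 3 * n.choose 4 ≤ n.choose 5 := by
  have h : n.choose 5 * 5 = n.choose 4 * (n - 4) := Nat.choose_succ_right_eq n 4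
  have : n.choose 4 * 15 ≤ n.choose 4 * (n - 4) := Nat.mul_le_mul_left _ (by omega)
  omega

theorem choose_five_le_of_base {n : ℕ} (hn : n = 22 ∨ n = 23) (μ : YoungDiagram)
    (hμ : μ.card = n) (hr : μ.rowLen 0 + 5 ≤ n) (hc : μ.colLen 0 + 5 ≤ n) :
    n.choose 5 ≤ μ.numSYT + n.choose 4 := by
  have hb : ∀ k, 4 ≤ k → 2 * (k + 1) ≤ n →
      n.choose (k + 1) ≤ μ.numSYT + n.choose k → n.choose 5 ≤ μ.numSYT + n.choose 4 := by
    intro k hk hk2 h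
    have hk3 : k ≤ 10 := by omega
    have h1 : n.choose 5 + n.choose k ≤ n.choose (k + 1) + n.choose 4 := by
      rcases hn with rfl | rfl <;> interval_cases k <;> decide
    omega
  by_cases h1 : 2 * μ.rowLen 0 < n
  · by_cases h2 : 2 * μ.colLen 0 < n
    · by_cases hd : 1 < μ.down.card
      · rcases hn with rfl | rfl
        · have := centralBound_twentytwo_twentythree.1 μ hμ (by omega) (by omega) hd
          have : Nat.choose 22 5 = 26334 := by decide
          have : Nat.choose 22 4 = 7315 := by decide
          omega
        · have := centralBound_twentytwo_twentythree.2 μ hμ (by omega) (by omega) hd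
          have : Nat.choose 23 5 = 33649 := by decide
          have : Nat.choose 23 4 = 8855 := by decide
          omega
      · exfalso
        have h3 := card_eq_mul_of_card_down_le_one (μ := μ) (by omega)
        have h4 : μ.rowLen 0 ≤ 11 := by omega
        generalize μ.rowLen 0 = a at *
        generalize μ.colLen 0 = b at *
        interval_cases a <;> omega
    · obtain ⟨k, hk⟩ := Nat.exists_eq_add_of_lt (show μ.colLen 0 < n by omega)
      exact hb k (by omega) (by omega)
        (choose_le_numSYT_add_col hμ (by omega) (by omega))
  · obtain ⟨k, hk⟩ := Nat.exists_eq_add_of_lt (show μ.rowLen 0 < n by omega)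
    exact hb k (by omega) (by omega) (choose_le_numSYT_add n k μ hμ (by omega) (by omega))

theorem choose_five_le_numSYT_add (n : ℕ) : ∀ (μ : YoungDiagram), 22 ≤ n → μ.card = n →
    μ.rowLen 0 + 5 ≤ n → μ.colLen 0 + 5 ≤ n → n.choose 5 ≤ μ.numSYT + n.choose 4 := by
  induction n using Nat.strong_induction_on with
  | _ n ih =>
    intro μ hn hμ hr hc
    by_cases hbase : n = 22 ∨ n = 23
    · exact choose_five_le_of_base hbase μ hμ hr hc
    by_cases hr5 : μ.rowLen 0 + 5 = n
    · exact choose_le_numSYT_add n 4 μ hμ hr5 (by omega)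
    by_cases hc5 : μ.colLen 0 + 5 = n
    · exact choose_le_numSYT_add_col hμ hc5 (by omega)
    obtain ⟨N, rfl⟩ : ∃ N, n = N + 2 := ⟨n - 2, by omega⟩
    have e5 : (N + 2).choose 5 = (N + 1).choose 4 + (N + 1).choose 5 := Nat.choose_succ_succ' (N + 1) 4
    have e4 : (N + 2).choose 4 = (N + 1).choose 3 + (N + 1).choose 4 := Nat.choose_succ_succ' (N + 1) 3
    by_cases hd : 1 < μ.down.card
    · obtain ⟨κ, hκ, ν, hν, hle⟩ := exists_pair_mem_down hd
      have h : ∀ ρ ∈ μ.down, (N + 1).choose 5 ≤ ρ.numSYT + (N + 1).choose 4 := by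
        intro ρ hρ
        have hρc := (mem_down.1 hρ).2
        have h1 := rowLen_le_of_mem_down hρ 0
        have h2 := colLen_le_of_mem_down hρ 0
        exact ih (N + 1) (by omega) ρ (by omega) (by omega) (by omega) (by omega)
      have := h κ hκ
      have := h ν hν
      have := three_mul_choose_four_le (n := N + 1) (by omega)
      omega
    · have h3 := card_eq_mul_of_card_down_le_one (μ := μ) (by omega)
      have hr2 : 2 ≤ μ.rowLen 0 := by
        by_contra h
        have : μ.rowLen 0 = 0 ∨ μ.rowLen 0 = 1 := by omega
        rcases this with h | h <;> rw [h] at h3 <;> omega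
      have hc2 : 2 ≤ μ.colLen 0 := by
        by_contra h
        have : μ.colLen 0 = 0 ∨ μ.colLen 0 = 1 := by omega
        rcases this with h | h <;> rw [h] at h3 <;> omega
      have h4 : 2 * μ.rowLen 0 ≤ μ.card := h3 ▸ Nat.mul_le_mul_right _ hc2
      have h5 : μ.colLen 0 * 2 ≤ μ.card := h3 ▸ Nat.mul_le_mul_left _ hr2
      obtain ⟨τ, hτ, hτd⟩ := exists_mem_down_of_card_down_le_one (by omega) hr2 hc2
      obtain ⟨κ, hκ, ν, hν, hle⟩ := exists_pair_mem_down hτd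
      have hτc := (mem_down.1 hτ).2
      have hτr := rowLen_le_of_mem_down hτ 0
      have hτl := colLen_le_of_mem_down hτ 0
      have h : ∀ ρ ∈ τ.down, N.choose 5 ≤ ρ.numSYT + N.choose 4 := by
        intro ρ hρ
        have hρc := (mem_down.1 hρ).2
        have h1 := rowLen_le_of_mem_down hρ 0
        have h2 := colLen_le_of_mem_down hρ 0
        exact ih N (by omega) ρ (by omega) (by omega) (by omega) (by omega)
      have := h κ hκ
      have := h ν hν
      have := numSYT_le_of_mem_down hτ
      have := three_mul_choose_four_le (n := N) (by omega)
      have : (N + 1).choose 5 = N.choose 4 + N.choose 5 := Nat.choose_succ_succ' N 4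
      have : (N + 1).choose 4 = N.choose 3 + N.choose 4 := Nat.choose_succ_succ' N 3
      have : (N + 1).choose 3 = N.choose 2 + N.choose 3 := Nat.choose_succ_succ' N 2
      omega

/-- The number of standard tableaux with `n` cells whose row lengths are `a ≥ b ≥ c ≥ d ≥ e`,
computed recursively. -/
def rowCount : ℕ → ℕ → ℕ → ℕ → ℕ → ℕ → ℕ
  | 0, _, _, _, _, _ => 1
  | n + 1, a, b, c, d, e =>
    (if b < a then rowCount n (a - 1) b c d e else 0) +
    (if c < b then rowCount n a (b - 1) c d e else 0) +
    (if d < c then rowCount n a b (c - 1) d e else 0) +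
    (if e < d then rowCount n a b c (d - 1) e else 0) +
    (if 0 < e then rowCount n a b c d (e - 1) else 0)

theorem numSYT_eq_rowCount (n : ℕ) : ∀ μ : YoungDiagram, μ.card = n → μ.rowLen 5 = 0 →
    μ.numSYT =
      rowCount n (μ.rowLen 0) (μ.rowLen 1) (μ.rowLen 2) (μ.rowLen 3) (μ.rowLen 4) := by
  induction n with
  | zero =>
    intro μ hμ _
    have : μ = ⊥ := (eq_of_le_of_card_le bot_le (by rw [hμ]; exact Nat.zero_le _)).symm
    rw [this, numSYT_bot, rowCount]
  | succ n ih =>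
    intro μ hμ h5
    have hrem : μ.remRows = (Finset.range 5).filter fun i => μ.rowLen (i + 1) < μ.rowLen i := by
      ext i
      rw [mem_remRows, Finset.mem_filter, Finset.mem_range]
      refine ⟨fun h => ⟨?_, h⟩, And.right⟩
      by_contra h6
      have := μ.rowLen_anti 5 i (by omega)
      omega
    have hih : ∀ i ∈ μ.remRows, (μ.remRow i).numSYT = rowCount n
        (if 0 = i then μ.rowLen i - 1 else μ.rowLen 0) (if 1 = i then μ.rowLen i - 1 else μ.rowLen 1)
        (if 2 = i then μ.rowLen i - 1 else μ.rowLen 2) (if 3 = i then μ.rowLen i - 1 else μ.rowLen 3)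
        (if 4 = i then μ.rowLen i - 1 else μ.rowLen 4) := by
      intro i hi
      have hc := card_remRow hi
      rw [ih _ (by omega)]
      · simp only [rowLen_remRow hi]
      · rw [rowLen_remRow hi]
        split_ifs with h
        · rw [← h, h5]
        · exact h5
    rw [numSYT_eq_sum_remRows hμ, Finset.sum_congr rfl hih, hrem, Finset.sum_filter, rowCount]
    simp only [Finset.sum_range_succ, Finset.sum_range_zero, zero_add, Nat.reduceAdd, h5]
    simp

theorem count_row (t : ℕ) :
    rowCount t t 0 0 0 0 = 1 := by
  induction t with
  | zero => decide
  | succ t ih =>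
    have h : rowCount (t + 1) (t + 1) 0 0 0 0 =
        rowCount t t 0 0 0 0 := by
      rw [rowCount]
      simp
    rw [h, ih]

theorem count_row_1 (t : ℕ) :
    rowCount (t + 2) (t + 1) 1 0 0 0 = (t + 1) := by
  induction t with
  | zero => decide
  | succ t ih =>
    have h : rowCount (t + 3) (t + 2) 1 0 0 0 =
        rowCount (t + 2) (t + 1) 1 0 0 0 +
          rowCount (t + 2) (t + 2) 0 0 0 0 := by
      rw [rowCount]
      simp
    have h1 := count_row (t + 2)
    simp only [add_assoc, Nat.reduceAdd] at *
    rw [h]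
    linarith

theorem count_row_2 (t : ℕ) :
    2 * rowCount (t + 4) (t + 2) 2 0 0 0 = (t + 4) * (t + 1) := by
  induction t with
  | zero => decide
  | succ t ih =>
    have h : rowCount (t + 5) (t + 3) 2 0 0 0 =
        rowCount (t + 4) (t + 2) 2 0 0 0 +
          rowCount (t + 4) (t + 3) 1 0 0 0 := by
      rw [rowCount]
      simp
    have h1 := count_row_1 (t + 2)
    simp only [add_assoc, Nat.reduceAdd] at *
    rw [h]
    linarith

theorem count_row_1_1 (t : ℕ) :
    2 * rowCount (t + 3) (t + 1) 1 1 0 0 = (t + 2) * (t + 1) := by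
  induction t with
  | zero => decide
  | succ t ih =>
    have h : rowCount (t + 4) (t + 2) 1 1 0 0 =
        rowCount (t + 3) (t + 1) 1 1 0 0 +
          rowCount (t + 3) (t + 2) 1 0 0 0 := by
      rw [rowCount]
      simp
    have h1 := count_row_1 (t + 1)
    simp only [add_assoc, Nat.reduceAdd] at *
    rw [h]
    linarith

theorem count_row_3 (t : ℕ) :
    6 * rowCount (t + 6) (t + 3) 3 0 0 0 = (t + 6) * (t + 5) * (t + 1) := by
  induction t with
  | zero => decide
  | succ t ih =>
    have h : rowCount (t + 7) (t + 4) 3 0 0 0 =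
        rowCount (t + 6) (t + 3) 3 0 0 0 +
          rowCount (t + 6) (t + 4) 2 0 0 0 := by
      rw [rowCount]
      simp
    have h1 := count_row_2 (t + 2)
    simp only [add_assoc, Nat.reduceAdd] at *
    rw [h]
    linarith

theorem count_row_2_1 (t : ℕ) :
    3 * rowCount (t + 5) (t + 2) 2 1 0 0 = (t + 5) * (t + 3) * (t + 1) := by
  induction t with
  | zero => decide
  | succ t ih =>
    have h : rowCount (t + 6) (t + 3) 2 1 0 0 =
        rowCount (t + 5) (t + 2) 2 1 0 0 +
          rowCount (t + 5) (t + 3) 1 1 0 0 +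
          rowCount (t + 5) (t + 3) 2 0 0 0 := by
      rw [rowCount]
      simp
    have h1 := count_row_1_1 (t + 2)
    have h2 := count_row_2 (t + 1)
    simp only [add_assoc, Nat.reduceAdd] at *
    rw [h]
    linarith

theorem count_row_1_1_1 (t : ℕ) :
    6 * rowCount (t + 4) (t + 1) 1 1 1 0 = (t + 3) * (t + 2) * (t + 1) := by
  induction t with
  | zero => decide
  | succ t ih =>
    have h : rowCount (t + 5) (t + 2) 1 1 1 0 =
        rowCount (t + 4) (t + 1) 1 1 1 0 +
          rowCount (t + 4) (t + 2) 1 1 0 0 := by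
      rw [rowCount]
      simp
    have h1 := count_row_1_1 (t + 1)
    simp only [add_assoc, Nat.reduceAdd] at *
    rw [h]
    linarith

theorem count_row_4 (t : ℕ) :
    24 * rowCount (t + 8) (t + 4) 4 0 0 0 = (t + 8) * (t + 7) * (t + 6) * (t + 1) := by
  induction t with
  | zero => decide
  | succ t ih =>
    have h : rowCount (t + 9) (t + 5) 4 0 0 0 =
        rowCount (t + 8) (t + 4) 4 0 0 0 +
          rowCount (t + 8) (t + 5) 3 0 0 0 := by
      rw [rowCount]
      simp
    have h1 := count_row_3 (t + 2)
    simp only [add_assoc, Nat.reduceAdd] at *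
    rw [h]
    linarith

theorem count_row_3_1 (t : ℕ) :
    8 * rowCount (t + 7) (t + 3) 3 1 0 0 = (t + 7) * (t + 6) * (t + 4) * (t + 1) := by
  induction t with
  | zero => decide
  | succ t ih =>
    have h : rowCount (t + 8) (t + 4) 3 1 0 0 =
        rowCount (t + 7) (t + 3) 3 1 0 0 +
          rowCount (t + 7) (t + 4) 2 1 0 0 +
          rowCount (t + 7) (t + 4) 3 0 0 0 := by
      rw [rowCount]
      simp
    have h1 := count_row_2_1 (t + 2)
    have h2 := count_row_3 (t + 1)
    simp only [add_assoc, Nat.reduceAdd] at *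
    rw [h]
    linarith

theorem count_row_2_2 (t : ℕ) :
    12 * rowCount (t + 6) (t + 2) 2 2 0 0 = (t + 6) * (t + 5) * (t + 2) * (t + 1) := by
  induction t with
  | zero => decide
  | succ t ih =>
    have h : rowCount (t + 7) (t + 3) 2 2 0 0 =
        rowCount (t + 6) (t + 2) 2 2 0 0 +
          rowCount (t + 6) (t + 3) 2 1 0 0 := by
      rw [rowCount]
      simp
    have h1 := count_row_2_1 (t + 1)
    simp only [add_assoc, Nat.reduceAdd] at *
    rw [h]
    linarith

theorem count_row_2_1_1 (t : ℕ) :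
    8 * rowCount (t + 6) (t + 2) 2 1 1 0 = (t + 6) * (t + 4) * (t + 3) * (t + 1) := by
  induction t with
  | zero => decide
  | succ t ih =>
    have h : rowCount (t + 7) (t + 3) 2 1 1 0 =
        rowCount (t + 6) (t + 2) 2 1 1 0 +
          rowCount (t + 6) (t + 3) 1 1 1 0 +
          rowCount (t + 6) (t + 3) 2 1 0 0 := by
      rw [rowCount]
      simp
    have h1 := count_row_1_1_1 (t + 2)
    have h2 := count_row_2_1 (t + 1)
    simp only [add_assoc, Nat.reduceAdd] at *
    rw [h]
    linarith

theorem count_row_1_1_1_1 (t : ℕ) :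
    24 * rowCount (t + 5) (t + 1) 1 1 1 1 = (t + 4) * (t + 3) * (t + 2) * (t + 1) := by
  induction t with
  | zero => decide
  | succ t ih =>
    have h : rowCount (t + 6) (t + 2) 1 1 1 1 =
        rowCount (t + 5) (t + 1) 1 1 1 1 +
          rowCount (t + 5) (t + 2) 1 1 1 0 := by
      rw [rowCount]
      simp
    have h1 := count_row_1_1_1 (t + 1)
    simp only [add_assoc, Nat.reduceAdd] at *
    rw [h]
    linarith

attribute [irreducible] rowCount

end YoungDiagram

theorem Nat.nth_eq_of_strictMono {p : ℕ → Prop} {N : ℕ} {f : ℕ → ℕ}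
    (hf : ∀ i j, i < j → j < N → f i < f j) (hp : ∀ i < N, p (f i))
    (hall : ∀ i < N, ∀ x < f i, p x → ∃ j < N, x = f j) {i : ℕ} (hi : i < N) :
    Nat.nth p i = f i := by
  classical
  have hcount : Nat.count p (f i) = i := by
    rw [Nat.count_eq_card_filter_range]
    have : (Finset.range (f i)).filter p = (Finset.range i).image f := by
      ext x
      rw [Finset.mem_filter, Finset.mem_range, Finset.mem_image]
      constructor
      · rintro ⟨hx, hpx⟩
        obtain ⟨j, hj, rfl⟩ := hall i hi x hx hpx
        refine ⟨j, ?_, rfl⟩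
        rw [Finset.mem_range]
        by_contra hij
        push Not at hij
        rcases hij.eq_or_lt with rfl | h
        · exact lt_irrefl _ hx
        · exact absurd (hf i j h hj) (by omega)
      · rintro ⟨j, hj, rfl⟩
        rw [Finset.mem_range] at hj
        exact ⟨hf j i hj hi, hp j (by omega)⟩
    rw [this, Finset.card_image_of_injOn, Finset.card_range]
    intro a ha b hb hab
    rw [Finset.mem_coe, Finset.mem_range] at ha hb
    by_contra hne
    rcases lt_or_gt_of_ne hne with h | h
    · have := hf a b h (by omega)
      omega
    · have := hf b a h (by omega)
      omega
  rw [← hcount, Nat.nth_count (hp i hi)]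
  rw [hcount]

namespace YoungDiagram

/-- The eleven smallest nontrivial character degrees of the symmetric group on `t + 22` letters. -/
def smallDegree (t : ℕ) : ℕ → ℕ
  | 0 => rowCount (t + 22) (t + 21) 1 0 0 0
  | 1 => rowCount (t + 22) (t + 20) 2 0 0 0
  | 2 => rowCount (t + 22) (t + 20) 1 1 0 0
  | 3 => rowCount (t + 22) (t + 19) 3 0 0 0
  | 4 => rowCount (t + 22) (t + 19) 1 1 1 0
  | 5 => rowCount (t + 22) (t + 19) 2 1 0 0
  | 6 => rowCount (t + 22) (t + 18) 4 0 0 0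
  | 7 => rowCount (t + 22) (t + 18) 1 1 1 1
  | 8 => rowCount (t + 22) (t + 18) 2 2 0 0
  | 9 => rowCount (t + 22) (t + 18) 3 1 0 0
  | _ => rowCount (t + 22) (t + 18) 2 1 1 0

theorem numSYT_of_rowLen_zero {t : ℕ} {μ : YoungDiagram} (hμ : μ.card = t + 22)
    (hr : t + 18 ≤ μ.rowLen 0) : μ.numSYT = 1 ∨ ∃ i < 11, μ.numSYT = smallDegree t i := by
  have h6 := sum_rowLen_le_card μ 6
  have h01 := μ.rowLen_anti 0 1 (by omega)
  have h12 := μ.rowLen_anti 1 2 (by omega)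
  have h23 := μ.rowLen_anti 2 3 (by omega)
  have h34 := μ.rowLen_anti 3 4 (by omega)
  have h45 := μ.rowLen_anti 4 5 (by omega)
  simp only [Finset.sum_range_succ, Finset.sum_range_zero, zero_add] at h6
  have h5 : μ.rowLen 5 = 0 := by omega
  have hsum := card_eq_sum_rowLen h5
  simp only [Finset.sum_range_succ, Finset.sum_range_zero, zero_add] at hsum
  rw [numSYT_eq_rowCount _ μ hμ h5]
  generalize μ.rowLen 0 = a at *
  generalize μ.rowLen 1 = b at *
  generalize μ.rowLen 2 = c at *
  generalize μ.rowLen 3 = d at *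
  generalize μ.rowLen 4 = e at *
  have hb : b ≤ 4 := by omega
  have hc : c ≤ 2 := by omega
  have hd : d ≤ 1 := by omega
  have he : e ≤ 1 := by omega
  have ha : a = t + 22 - (b + c + d + e) := by omega
  clear hsum h6 h5 h45 hμ
  interval_cases e <;> interval_cases d <;> interval_cases c <;> interval_cases b <;>
    try omega
  · obtain rfl : a = t + 22 := by omega
    exact Or.inl (count_row _)
  · obtain rfl : a = t + 21 := by omega
    exact Or.inr ⟨0, by omega, by simp only [smallDegree]⟩
  · obtain rfl : a = t + 20 := by omega
    exact Or.inr ⟨1, by omega, by simp only [smallDegree]⟩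
  · obtain rfl : a = t + 19 := by omega
    exact Or.inr ⟨3, by omega, by simp only [smallDegree]⟩
  · obtain rfl : a = t + 18 := by omega
    exact Or.inr ⟨6, by omega, by simp only [smallDegree]⟩
  · obtain rfl : a = t + 20 := by omega
    exact Or.inr ⟨2, by omega, by simp only [smallDegree]⟩
  · obtain rfl : a = t + 19 := by omega
    exact Or.inr ⟨5, by omega, by simp only [smallDegree]⟩
  · obtain rfl : a = t + 18 := by omega
    exact Or.inr ⟨9, by omega, by simp only [smallDegree]⟩
  · obtain rfl : a = t + 18 := by omega
    exact Or.inr ⟨8, by omega, by simp only [smallDegree]⟩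
  · obtain rfl : a = t + 19 := by omega
    exact Or.inr ⟨4, by omega, by simp only [smallDegree]⟩
  · obtain rfl : a = t + 18 := by omega
    exact Or.inr ⟨10, by omega, by simp only [smallDegree]⟩
  · obtain rfl : a = t + 18 := by omega
    exact Or.inr ⟨7, by omega, by simp only [smallDegree]⟩

theorem smallDegree_zero (t : ℕ) :
    smallDegree t 0 = t + 21 := by
  simpa only [smallDegree, add_assoc, Nat.reduceAdd] using count_row_1 (t + 20)

theorem smallDegree_one (t : ℕ) :
    2 * smallDegree t 1 = (t + 22) * (t + 19) := by
  simpa only [smallDegree, add_assoc, Nat.reduceAdd] using count_row_2 (t + 18)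

theorem smallDegree_two (t : ℕ) :
    2 * smallDegree t 2 = (t + 21) * (t + 20) := by
  simpa only [smallDegree, add_assoc, Nat.reduceAdd] using count_row_1_1 (t + 19)

theorem smallDegree_three (t : ℕ) :
    6 * smallDegree t 3 = (t + 22) * (t + 21) * (t + 17) := by
  simpa only [smallDegree, add_assoc, Nat.reduceAdd] using count_row_3 (t + 16)

theorem smallDegree_four (t : ℕ) :
    6 * smallDegree t 4 = (t + 21) * (t + 20) * (t + 19) := by
  simpa only [smallDegree, add_assoc, Nat.reduceAdd] using count_row_1_1_1 (t + 18)

theorem smallDegree_five (t : ℕ) :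
    3 * smallDegree t 5 = (t + 22) * (t + 20) * (t + 18) := by
  simpa only [smallDegree, add_assoc, Nat.reduceAdd] using count_row_2_1 (t + 17)

theorem smallDegree_six (t : ℕ) :
    24 * smallDegree t 6 = (t + 22) * (t + 21) * (t + 20) * (t + 15) := by
  simpa only [smallDegree, add_assoc, Nat.reduceAdd] using count_row_4 (t + 14)

theorem smallDegree_seven (t : ℕ) :
    24 * smallDegree t 7 = (t + 21) * (t + 20) * (t + 19) * (t + 18) := by
  simpa only [smallDegree, add_assoc, Nat.reduceAdd] using count_row_1_1_1_1 (t + 17)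

theorem smallDegree_eight (t : ℕ) :
    12 * smallDegree t 8 = (t + 22) * (t + 21) * (t + 18) * (t + 17) := by
  simpa only [smallDegree, add_assoc, Nat.reduceAdd] using count_row_2_2 (t + 16)

theorem smallDegree_nine (t : ℕ) :
    8 * smallDegree t 9 = (t + 22) * (t + 21) * (t + 19) * (t + 16) := by
  simpa only [smallDegree, add_assoc, Nat.reduceAdd] using count_row_3_1 (t + 15)

theorem smallDegree_ten (t : ℕ) :
    8 * smallDegree t 10 = (t + 22) * (t + 20) * (t + 19) * (t + 17) := by
  simpa only [smallDegree, add_assoc, Nat.reduceAdd] using count_row_2_1_1 (t + 16)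

theorem smallDegree_strictMono {t i : ℕ} (hi : i < 10) :
    smallDegree t i < smallDegree t (i + 1) := by
  have h2 := Nat.zero_le (t ^ 2)
  have h3 := Nat.zero_le (t ^ 3)
  have h4 := Nat.zero_le (t ^ 4)
  interval_cases i <;> simp only [Nat.reduceAdd]
  · have h := smallDegree_zero t
    have h' := smallDegree_one t
    ring_nf at h h'
    omega
  · have h := smallDegree_one t
    have h' := smallDegree_two t
    ring_nf at h h'
    omega
  · have h := smallDegree_two t
    have h' := smallDegree_three t
    ring_nf at h h'
    omega
  · have h := smallDegree_three t
    have h' := smallDegree_four t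
    ring_nf at h h'
    omega
  · have h := smallDegree_four t
    have h' := smallDegree_five t
    ring_nf at h h'
    omega
  · have h := smallDegree_five t
    have h' := smallDegree_six t
    ring_nf at h h'
    omega
  · have h := smallDegree_six t
    have h' := smallDegree_seven t
    ring_nf at h h'
    omega
  · have h := smallDegree_seven t
    have h' := smallDegree_eight t
    ring_nf at h h'
    omega
  · have h := smallDegree_eight t
    have h' := smallDegree_nine t
    ring_nf at h h'
    omega
  · have h := smallDegree_nine t
    have h' := smallDegree_ten t
    ring_nf at h h'
    omega

theorem one_lt_smallDegree {t i : ℕ} (hi : i < 11) : 1 < smallDegree t i := by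
  induction i with
  | zero =>
    have := smallDegree_zero t
    omega
  | succ i ih =>
    have := smallDegree_strictMono (t := t) (i := i) (by omega)
    have := ih (by omega)
    omega

theorem smallDegree_lt {t i j : ℕ} (hij : i < j) (hj : j < 11) :
    smallDegree t i < smallDegree t j := by
  induction j with
  | zero => omega
  | succ j ih =>
    have := smallDegree_strictMono (t := t) (i := j) (by omega)
    rcases (Nat.lt_succ_iff.1 hij).eq_or_lt with rfl | h
    · exact this
    · exact (ih h (by omega)).trans this

theorem smallDegree_ten_lt {t : ℕ} {x : ℕ}
    (hx : (t + 22).choose 5 ≤ x + (t + 22).choose 4) : smallDegree t 10 < x := by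
  have h5 := Nat.descFactorial_eq_factorial_mul_choose (t + 22) 5
  have h4 := Nat.descFactorial_eq_factorial_mul_choose (t + 22) 4
  have h10 := smallDegree_ten t
  have e4 : (t + 22).descFactorial 4 = (t + 19) * (t + 20) * (t + 21) * (t + 22) := by
    simp [Nat.descFactorial_succ]
    ring
  have e5 : (t + 22).descFactorial 5 = (t + 18) * (t + 22).descFactorial 4 := by
    simp [Nat.descFactorial_succ]
  rw [e5, e4] at h5
  rw [e4] at h4
  simp only [Nat.factorial] at h4 h5
  ring_nf at h4 h5 h10
  have := Nat.zero_le (t ^ 2)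
  have := Nat.zero_le (t ^ 3)
  have := Nat.zero_le (t ^ 4)
  have := Nat.zero_le (t ^ 5)
  rw [add_comm t 22] at hx
  omega

theorem numSYT_eq_smallDegree {t : ℕ} {μ : YoungDiagram} (hμ : μ.card = t + 22)
    (h1 : μ.numSYT ≠ 1) (hle : μ.numSYT ≤ smallDegree t 10) :
    ∃ i < 11, μ.numSYT = smallDegree t i := by
  by_cases hr : t + 18 ≤ μ.rowLen 0
  · exact (numSYT_of_rowLen_zero hμ hr).resolve_left h1
  by_cases hc : t + 18 ≤ μ.colLen 0
  · rw [← numSYT_transpose _ μ hμ] at h1 ⊢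
    exact (numSYT_of_rowLen_zero ((card_transpose μ).trans hμ) (by simpa using hc)).resolve_left h1
  · have := smallDegree_ten_lt
      (choose_five_le_numSYT_add _ μ (by omega) hμ (by omega) (by omega))
    omega

theorem exists_rowLens {a b c d e : ℕ} (hab : b ≤ a) (hbc : c ≤ b) (hcd : d ≤ c) (hde : e ≤ d) :
    ∃ μ : YoungDiagram, μ.card = a + b + c + d + e ∧
      μ.numSYT = rowCount (a + b + c + d + e) a b c d e := by
  have hw : [a, b, c, d, e].SortedGE := by
    simp [List.sortedGE_iff_pairwise]
    omega
  let μ := ofRowLens [a, b, c, d, e] hw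
  have h0 : μ.rowLen 0 = a := rowLen_ofRowLens (hw := hw) ⟨0, by simp⟩
  have h1 : μ.rowLen 1 = b := rowLen_ofRowLens (hw := hw) ⟨1, by simp⟩
  have h2 : μ.rowLen 2 = c := rowLen_ofRowLens (hw := hw) ⟨2, by simp⟩
  have h3 : μ.rowLen 3 = d := rowLen_ofRowLens (hw := hw) ⟨3, by simp⟩
  have h4 : μ.rowLen 4 = e := rowLen_ofRowLens (hw := hw) ⟨4, by simp⟩
  have h5 : μ.rowLen 5 = 0 := by
    by_contra h
    have : (5, 0) ∈ μ := mem_iff_lt_rowLen.2 (by omega)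
    rw [mem_ofRowLens] at this
    obtain ⟨h, -⟩ := this
    simp at h
  have hc : μ.card = a + b + c + d + e := by
    rw [card_eq_sum_rowLen h5]
    simp only [Finset.sum_range_succ, Finset.sum_range_zero, zero_add, h0, h1, h2, h3, h4]
  exact ⟨μ, hc, by rw [numSYT_eq_rowCount _ μ hc h5, h0, h1, h2, h3, h4]⟩

theorem exists_numSYT_eq_smallDegree (t : ℕ) {i : ℕ} (hi : i < 11) :
    ∃ μ : YoungDiagram, μ.card = t + 22 ∧ μ.numSYT = smallDegree t i := by
  interval_cases i <;> simp only [smallDegree]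
  · exact exists_rowLens (a := t + 21) (b := 1) (c := 0) (d := 0) (e := 0)
      (by omega) (by omega) (by omega) (by omega)
  · exact exists_rowLens (a := t + 20) (b := 2) (c := 0) (d := 0) (e := 0)
      (by omega) (by omega) (by omega) (by omega)
  · exact exists_rowLens (a := t + 20) (b := 1) (c := 1) (d := 0) (e := 0)
      (by omega) (by omega) (by omega) (by omega)
  · exact exists_rowLens (a := t + 19) (b := 3) (c := 0) (d := 0) (e := 0)
      (by omega) (by omega) (by omega) (by omega)
  · exact exists_rowLens (a := t + 19) (b := 1) (c := 1) (d := 1) (e := 0)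
      (by omega) (by omega) (by omega) (by omega)
  · exact exists_rowLens (a := t + 19) (b := 2) (c := 1) (d := 0) (e := 0)
      (by omega) (by omega) (by omega) (by omega)
  · exact exists_rowLens (a := t + 18) (b := 4) (c := 0) (d := 0) (e := 0)
      (by omega) (by omega) (by omega) (by omega)
  · exact exists_rowLens (a := t + 18) (b := 1) (c := 1) (d := 1) (e := 1)
      (by omega) (by omega) (by omega) (by omega)
  · exact exists_rowLens (a := t + 18) (b := 2) (c := 2) (d := 0) (e := 0)
      (by omega) (by omega) (by omega) (by omega)
  · exact exists_rowLens (a := t + 18) (b := 3) (c := 1) (d := 0) (e := 0)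
      (by omega) (by omega) (by omega) (by omega)
  · exact exists_rowLens (a := t + 18) (b := 2) (c := 1) (d := 1) (e := 0)
      (by omega) (by omega) (by omega) (by omega)

end YoungDiagram

/-- The eleven smallest nontrivial character degrees of the symmetric group on `t + 22` letters. -/
theorem dDeg_perm (t : ℕ) {i : ℕ} (hi : i < 11) :
    dDeg (Equiv.Perm (Fin (t + 22))) (i + 1) = YoungDiagram.smallDegree t i := by
  rw [dDeg, Nat.add_sub_cancel]
  have hcd : cd (Equiv.Perm (Fin (t + 22)))
      = {d | ∃ μ : YoungDiagram, μ.card = t + 22 ∧ μ.numSYT = d} := YoungDiagram.cd_perm (t + 21)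
  rw [hcd]
  refine Nat.nth_eq_of_strictMono (N := 11)
    (fun i j hij hj => YoungDiagram.smallDegree_lt hij hj) ?_ ?_ hi
  · intro i hi
    exact ⟨YoungDiagram.exists_numSYT_eq_smallDegree t hi,
      (YoungDiagram.one_lt_smallDegree hi).ne'⟩
  · rintro i hi _ hx ⟨⟨μ, hμ, rfl⟩, h1⟩
    refine YoungDiagram.numSYT_eq_smallDegree hμ h1 (hx.le.trans ?_)
    rcases (Nat.lt_succ_iff.1 hi).eq_or_lt with rfl | h
    · exact le_rfl
    · exact (YoungDiagram.smallDegree_lt h (by omega)).le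

theorem stmt9 (n : ℕ) (hn : 22 ≤ n) :
    dDeg (Equiv.Perm (Fin n)) 7 = n * (n - 1) * (n - 2) * (n - 7) / 24 ∧
    dDeg (Equiv.Perm (Fin n)) 8 = (n - 1) * (n - 2) * (n - 3) * (n - 4) / 24 ∧
    dDeg (Equiv.Perm (Fin n)) 9 = n * (n - 1) * (n - 4) * (n - 5) / 12 ∧
    dDeg (Equiv.Perm (Fin n)) 10 = n * (n - 1) * (n - 3) * (n - 6) / 8 ∧
    dDeg (Equiv.Perm (Fin n)) 11 = n * (n - 2) * (n - 3) * (n - 5) / 8 := by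
  obtain ⟨t, rfl⟩ := Nat.exists_eq_add_of_le' hn
  refine ⟨(dDeg_perm t (i := 6) (by omega)).trans ?_, (dDeg_perm t (i := 7) (by omega)).trans ?_,
    (dDeg_perm t (i := 8) (by omega)).trans ?_, (dDeg_perm t (i := 9) (by omega)).trans ?_,
    (dDeg_perm t (i := 10) (by omega)).trans ?_⟩
  · exact (Nat.div_eq_of_eq_mul_right (by omega) (YoungDiagram.smallDegree_six t).symm).symm
  · exact (Nat.div_eq_of_eq_mul_right (by omega) (YoungDiagram.smallDegree_seven t).symm).symm
  · exact (Nat.div_eq_of_eq_mul_right (by omega) (YoungDiagram.smallDegree_eight t).symm).symm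
  · exact (Nat.div_eq_of_eq_mul_right (by omega) (YoungDiagram.smallDegree_nine t).symm).symm
  · exact (Nat.div_eq_of_eq_mul_right (by omega) (YoungDiagram.smallDegree_ten t).symm).symm
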